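/- arXiv:0803.2389 — 4 statements merged into one kernel-verified Lean document; each statement's English description precedes it below -/
import Mathlib

section
/- Let F : ℝ^m → ℝ^n be Lebesgue measurable and suppose that at λ^m-almost every point x ∈ ℝ^m all m partial derivatives of F in the coordinate directions exist; let G : ℝ^m → ℝ^{n×m} denote the almost-everywhere defined matrix of these partial derivatives. Then for every ε > 0 there exists a continuously differentiable function F_ε ∈ C¹(ℝ^m, ℝ^n) such that λ^m({x : F(x) ≠ F_ε(x)} ∪ {x : G(x) ≠ DF_ε(x)}) < ε, where DF_ε is the Jacobian matrix of F_ε and λ^m is Lebesgue measure on ℝ^m. -/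
open MeasureTheory Set Filter

open scoped Topology ENNReal NNReal

/-- A function which agrees with `C¹` functions on countably many sets covering almost all of the
space agrees with a single `C¹` function outside a set of small measure. -/
theorem exists_contDiff_measure_ne_lt_of_iUnion {E V ι : Type*} [NormedAddCommGroup E]
    [NormedSpace ℝ E] [FiniteDimensional ℝ E] [MeasurableSpace E] [BorelSpace E]
    [NormedAddCommGroup V] [NormedSpace ℝ V] [Countable ι] (μ : Measure E)
    [IsLocallyFiniteMeasure μ] {F : E → V} {A : ι → Set E} (hA : ∀ j, MeasurableSet (A j))
    (hfin : ∀ j, μ (A j) ≠ ∞) (hcover : ∀ᵐ x ∂μ, x ∈ ⋃ j, A j)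
    (hF : ∀ j, ∃ f : E → V, ContDiff ℝ 1 f ∧ EqOn F f (A j)) {ε : ℝ≥0∞} (hε : ε ≠ 0) :
    ∃ f : E → V, ContDiff ℝ 1 f ∧ μ {x | F x ≠ f x} < ε := by
  obtain ⟨ε', hε'0, hε'⟩ := ENNReal.exists_pos_sum_of_countable' (ENNReal.half_pos hε).ne' ι
  have hhalf : ∀ j, ε' j / 2 ≠ 0 := fun j => (ENNReal.half_pos (hε'0 j).ne').ne'
  choose U hAU hUo _ hU using fun j =>
    (hA j).exists_isOpen_sdiff_lt (hfin j) (hhalf j)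
  choose C hCA hCc hC using fun j =>
    (hA j).exists_isClosed_sdiff_lt (hfin j) (hhalf j)
  obtain ⟨W, hW, hWo, hWε⟩ := Set.exists_isOpen_lt_of_lt (μ := μ) (⋃ j, A j)ᶜ (ε / 2)
    (by rw [show μ (⋃ j, A j)ᶜ = 0 from hcover]; exact ENNReal.half_pos hε)
  set K : Set E := (W ∪ ⋃ j, U j \ C j)ᶜ with hK
  have hKc : IsClosed K :=
    (hWo.union (isOpen_iUnion fun j => (hUo j).sdiff (hCc j))).isClosed_compl
  have hKμ : μ Kᶜ < ε := by
    rw [hK, compl_compl]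
    calc μ (W ∪ ⋃ j, U j \ C j) ≤ μ W + ∑' j, μ (U j \ C j) :=
          (measure_union_le _ _).trans (by gcongr; exact measure_iUnion_le _)
      _ ≤ μ W + ∑' j, ε' j := by
          gcongr with j
          calc μ (U j \ C j) ≤ μ (U j \ A j ∪ A j \ C j) := by
                gcongr
                intro x hx
                by_cases hxA : x ∈ A j
                · exact Or.inr ⟨hxA, hx.2⟩
                · exact Or.inl ⟨hx.1, hxA⟩
            _ ≤ ε' j / 2 + ε' j / 2 :=
                (measure_union_le _ _).trans (add_le_add (hU j).le (hC j).le)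
            _ = ε' j := ENNReal.add_halves _
      _ < ε / 2 + ε / 2 := ENNReal.add_lt_add hWε hε'
      _ = ε := ENNReal.add_halves _
  classical
  obtain ⟨g, hg⟩ := exists_contMDiffMap_forall_mem_convex_of_local (n := 1) (F := V)
    (modelWithCornersSelf ℝ E) (t := fun x => if x ∈ K then {F x} else univ)
    (fun x => by
      split_ifs
      · exact convex_singleton _
      · exact convex_univ)
    (fun x => by
      by_cases hx : x ∈ K
      · have hx' : x ∈ ⋃ j, A j := by
          by_contra h
          exact hx (Or.inl (hW h))
        obtain ⟨j, hj⟩ := mem_iUnion.1 hx'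
        obtain ⟨f, hf, hFf⟩ := hF j
        refine ⟨U j, (hUo j).mem_nhds (hAU j hj), f, hf.contMDiff.contMDiffOn, fun y hy => ?_⟩
        split_ifs with hyK
        · have : y ∈ C j := by
            by_contra h
            exact hyK (Or.inr (mem_iUnion.2 ⟨j, hy, h⟩))
          exact (hFf (hCA j this)).symm
        · trivial
      · refine ⟨Kᶜ, hKc.isOpen_compl.mem_nhds hx, fun _ => 0, contMDiffOn_const, fun y hy => ?_⟩
        rw [if_neg hy]
        trivial)
  have hsub : {x | F x ≠ g x} ⊆ Kᶜ := fun x hx hxK => by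
    have := hg x
    rw [if_pos hxK] at this
    exact hx (mem_singleton_iff.1 this).symm
  exact ⟨g, g.contMDiff.contDiff, (measure_mono hsub).trans_lt hKμ⟩

/-- Almost every point of `A` is a density point of `A` along the line in direction `v`. -/
theorem ae_forall_volume_line_notMem_le {E : Type*} [NormedAddCommGroup E]
    [NormedSpace ℝ E] [FiniteDimensional ℝ E] [MeasurableSpace E] [BorelSpace E]
    (μ : Measure E) [μ.IsAddHaarMeasure] {A : Set E} (hA : MeasurableSet A) (v : E) {c : ℝ≥0∞}
    (hc : c ≠ 0) :
    ∀ᵐ x ∂μ, x ∈ A → ∃ k : ℕ, ∀ q : ℚ, 0 < q → (q : ℝ) < 1 / (k + 1) →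
      volume {t : ℝ | |t| ≤ q ∧ x + t • v ∉ A} ≤ c * ENNReal.ofReal q := by
  have : ProperSpace E := FiniteDimensional.proper ℝ E
  refine ae_mem_of_ae_add_linearMap_mem (LinearMap.toSpanSingleton ℝ E v) volume μ
    (s := {x | x ∈ A → ∃ k : ℕ, ∀ q : ℚ, 0 < q → (q : ℝ) < 1 / (k + 1) →
      volume {t : ℝ | |t| ≤ q ∧ x + t • v ∉ A} ≤ c * ENNReal.ofReal q}) ?_ fun y => ?_
  · have hmeas : ∀ q : ℚ, Measurable fun x : E => volume {t : ℝ | |t| ≤ q ∧ x + t • v ∉ A} := by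
      intro q
      have : MeasurableSet {p : E × ℝ | |p.2| ≤ q ∧ p.1 + p.2 • v ∉ A} := by
        have h1 : MeasurableSet {p : E × ℝ | |p.2| ≤ q} :=
          measurableSet_le (by fun_prop) (by fun_prop)
        have h2 : Measurable fun p : E × ℝ => p.1 + p.2 • v :=
          (by fun_prop : Continuous fun p : E × ℝ => p.1 + p.2 • v).measurable
        exact h1.inter (h2 hA.compl)
      exact measurable_measure_prodMk_left this
    have h : MeasurableSet {x : E | ∃ k : ℕ, ∀ q : ℚ, 0 < q → (q : ℝ) < 1 / (k + 1) →
        volume {t : ℝ | |t| ≤ q ∧ x + t • v ∉ A} ≤ c * ENNReal.ofReal q} := by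
      simp only [ofPred_forall, ofPred_exists]
      exact MeasurableSet.iUnion fun k => MeasurableSet.iInter fun q =>
        MeasurableSet.iInter fun _ => MeasurableSet.iInter fun _ =>
          measurableSet_le (hmeas q) measurable_const
    exact MeasurableSet.imp hA h
  · set B : Set ℝ := {t | y + t • v ∈ A} with hB
    have hBm : MeasurableSet B :=
      (by fun_prop : Continuous fun t : ℝ => y + t • v).measurable hA
    filter_upwards [Besicovitch.ae_tendsto_measure_inter_div_of_measurableSet volume hBm.compl]
      with s hs
    simp only [LinearMap.toSpanSingleton_apply]
    intro hsA
    have hsB : s ∉ Bᶜ := not_not.2 hsA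
    rw [indicator_of_notMem hsB] at hs
    have hc2 : (0 : ℝ≥0∞) < c / 2 := ENNReal.half_pos hc
    have hev := hs.eventually (gt_mem_nhds hc2)
    obtain ⟨δ, hδ, hδs⟩ := mem_nhdsGT_iff_exists_Ioo_subset.1 hev
    obtain ⟨k, hk⟩ := exists_nat_one_div_lt (show (0 : ℝ) < δ from hδ)
    refine ⟨k, fun q hq hqk => ?_⟩
    have hq' : (0 : ℝ) < q := by exact_mod_cast hq
    have h1 := hδs ⟨hq', hqk.trans hk⟩
    simp only [mem_ofPred_eq, Real.volume_closedBall] at h1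
    have h2 := (ENNReal.div_le_iff (by simpa using hq) (by finiteness)).1 (le_of_lt h1)
    have h3 : {t : ℝ | |t| ≤ q ∧ y + s • v + t • v ∉ A}
        = (fun t => s + t) ⁻¹' (Bᶜ ∩ Metric.closedBall s q) := by
      ext t
      simp [hB, add_smul, add_assoc, and_comm]
    rw [h3, measure_preimage_add]
    refine h2.trans (le_of_eq ?_)
    rw [ENNReal.ofReal_mul (by norm_num), ← mul_assoc, ENNReal.ofReal_ofNat,
      ENNReal.div_mul_cancel (by norm_num) (by norm_num)]

/-- `F` is Lipschitz on `A` at small scales, for pairs of points which differ only in the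
coordinates of `s`. -/
def LocLipschitzAlong {ι V : Type*} [Fintype ι] [NormedAddCommGroup V] (F : (ι → ℝ) → V)
    (s : Finset ι) (A : Set (ι → ℝ)) : Prop :=
  ∃ M r : ℝ, 0 ≤ M ∧ 0 < r ∧ ∀ x ∈ A, ∀ y ∈ A, (∀ i ∉ s, x i = y i) → dist x y < r →
    ‖F x - F y‖ ≤ M * dist x y

/-- The points of `A` from which most short moves in direction `v` stay in `A` and change `F` by
at most `k` times the length of the move. -/
def lineGoodSet {E V : Type*} [NormedAddCommGroup E] [NormedSpace ℝ E] [NormedAddCommGroup V]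
    (F : E → V) (A : Set E) (v : E) (k : ℕ) : Set E :=
  {x | x ∈ A ∧ ∀ q : ℚ, 0 < q → (q : ℝ) < 1 / (k + 1) →
    volume {t : ℝ | |t| ≤ q ∧ ¬ (x + t • v ∈ A ∧ ‖F (x + t • v) - F x‖ ≤ k * |t|)}
      ≤ 8⁻¹ * ENNReal.ofReal q}

theorem measurableSet_lineGoodSet {E V : Type*} [NormedAddCommGroup E] [NormedSpace ℝ E]
    [FiniteDimensional ℝ E] [MeasurableSpace E] [BorelSpace E] [NormedAddCommGroup V]
    [MeasurableSpace V] [BorelSpace V] [SecondCountableTopology V] {F : E → V}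
    (hF : Measurable F) {A : Set E} (hA : MeasurableSet A) (v : E) (k : ℕ) :
    MeasurableSet (lineGoodSet F A v k) := by
  have : ProperSpace E := FiniteDimensional.proper ℝ E
  have hmeas : ∀ q : ℚ, Measurable fun x : E => volume {t : ℝ | |t| ≤ q ∧
      ¬ (x + t • v ∈ A ∧ ‖F (x + t • v) - F x‖ ≤ k * |t|)} := by
    intro q
    have h2 : Measurable fun p : E × ℝ => p.1 + p.2 • v :=
      (by fun_prop : Continuous fun p : E × ℝ => p.1 + p.2 • v).measurable
    have : MeasurableSet {p : E × ℝ | |p.2| ≤ q ∧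
        ¬ (p.1 + p.2 • v ∈ A ∧ ‖F (p.1 + p.2 • v) - F p.1‖ ≤ k * |p.2|)} := by
      have h1 : MeasurableSet {p : E × ℝ | |p.2| ≤ q} :=
        measurableSet_le (by fun_prop) (by fun_prop)
      have h3 : MeasurableSet {p : E × ℝ | ‖F (p.1 + p.2 • v) - F p.1‖ ≤ k * |p.2|} :=
        measurableSet_le ((hF.comp h2).sub (hF.comp measurable_fst)).norm (by fun_prop)
      exact h1.inter ((h2 hA).inter h3).compl
    exact measurable_measure_prodMk_left this
  unfold lineGoodSet
  simp only [ofPred_and, ofPred_forall]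
  exact hA.inter <| MeasurableSet.iInter fun q => MeasurableSet.iInter fun _ =>
    MeasurableSet.iInter fun _ => measurableSet_le (hmeas q) measurable_const

theorem ae_mem_iUnion_lineGoodSet {E V : Type*} [NormedAddCommGroup E] [NormedSpace ℝ E]
    [FiniteDimensional ℝ E] [MeasurableSpace E] [BorelSpace E] (μ : Measure E)
    [μ.IsAddHaarMeasure] [NormedAddCommGroup V] {F : E → V} {A : Set E} (hA : MeasurableSet A)
    (v : E) (hF : ∀ᵐ x ∂μ, ∃ C : ℝ, ∀ᶠ t in 𝓝 (0 : ℝ), ‖F (x + t • v) - F x‖ ≤ C * |t|) :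
    ∀ᵐ x ∂μ, x ∈ A → x ∈ ⋃ k, lineGoodSet F A v k := by
  filter_upwards [hF, ae_forall_volume_line_notMem_le μ hA v
    (c := 8⁻¹) (by simp)] with x ⟨C, hC⟩ hx hxA
  obtain ⟨k₁, hk₁⟩ := hx hxA
  obtain ⟨δ, hδ, hδC⟩ := Metric.eventually_nhds_iff.1 hC
  obtain ⟨k₂, hk₂⟩ := exists_nat_one_div_lt hδ
  obtain ⟨k₃, hk₃⟩ := exists_nat_ge C
  have hle : ∀ a b : ℕ, a ≤ b → (1 : ℝ) / (b + 1) ≤ 1 / (a + 1) := fun a b h =>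
    Nat.one_div_le_one_div h
  refine mem_iUnion.2 ⟨max k₁ (max k₂ k₃), hxA, fun q hq hqk => ?_⟩
  refine (measure_mono ?_).trans (hk₁ q hq (hqk.trans_le (hle _ _ (le_max_left _ _))))
  rintro t ⟨htq, ht⟩
  refine ⟨htq, fun htA => ht ⟨htA, ?_⟩⟩
  have h1 : ‖F (x + t • v) - F x‖ ≤ C * |t| := by
    apply hδC
    rw [Real.dist_eq, sub_zero]
    refine (htq.trans_lt (hqk.trans_le (hle _ _ ?_))).trans hk₂
    exact (le_max_left _ _).trans (le_max_right _ _)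
  have h2 : C ≤ (max k₁ (max k₂ k₃) : ℕ) := hk₃.trans (by
    exact_mod_cast (le_max_right _ _).trans (le_max_right _ _))
  exact h1.trans (by gcongr)

theorem LocLipschitzAlong.insert_lineGoodSet {ι V : Type*} [Fintype ι] [DecidableEq ι]
    [NormedAddCommGroup V] {F : (ι → ℝ) → V} {s : Finset ι} {A : Set (ι → ℝ)}
    (h : LocLipschitzAlong F s A) (i : ι) (k : ℕ) :
    LocLipschitzAlong F (insert i s) (lineGoodSet F A (Pi.single i 1) k) := by
  obtain ⟨M, r, hM, hr, h⟩ := h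
  refine ⟨M + 3 * k, min r (1 / (3 * (k + 1))), by positivity, lt_min hr (by positivity), ?_⟩
  intro x hx y hy hxy hdist
  rcases eq_or_lt_of_le (dist_nonneg : 0 ≤ dist x y) with h0 | hpos
  · rw [dist_eq_zero.1 h0.symm]
    simp
  set ρ := dist x y with hρ
  obtain ⟨q, hq1, hq2⟩ := exists_rat_btwn (show 2 * ρ < 3 * ρ by linarith)
  have hqk : (q : ℝ) < 1 / (k + 1) := by
    have h1 := hdist.trans_le (min_le_right _ _)
    have h2 : (1 : ℝ) / (3 * (k + 1)) = 1 / (k + 1) / 3 := by field_simp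
    linarith
  have hq0 : (0 : ℝ) < q := by linarith
  have hq0' : 0 < q := by exact_mod_cast hq0
  set T : (ι → ℝ) → Set ℝ := fun x => {t : ℝ | |t| ≤ q ∧ ¬ (x + t • (Pi.single i 1 : ι → ℝ) ∈ A ∧
    ‖F (x + t • (Pi.single i 1 : ι → ℝ)) - F x‖ ≤ k * |t|)} with hT
  have hTx : volume ((fun z => -x i + z) ⁻¹' T x) ≤ 8⁻¹ * ENNReal.ofReal q := by
    rw [measure_preimage_add]
    exact hx.2 q hq0' hqk
  have hTy : volume ((fun z => -y i + z) ⁻¹' T y) ≤ 8⁻¹ * ENNReal.ofReal q := by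
    rw [measure_preimage_add]
    exact hy.2 q hq0' hqk
  obtain ⟨z, hz, hzT⟩ : ∃ z ∈ Icc (x i) (x i + ρ),
      z ∉ (fun z => -x i + z) ⁻¹' T x ∪ (fun z => -y i + z) ⁻¹' T y := by
    by_contra! hcon
    have h1 : volume (Icc (x i) (x i + ρ)) ≤ 8⁻¹ * ENNReal.ofReal q + 8⁻¹ * ENNReal.ofReal q :=
      (measure_mono hcon).trans ((measure_union_le _ _).trans (add_le_add hTx hTy))
    have h8 : (8⁻¹ : ℝ≥0∞) = ENNReal.ofReal (8⁻¹ : ℝ) := by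
      rw [ENNReal.ofReal_inv_of_pos (by norm_num), ENNReal.ofReal_ofNat]
    rw [Real.volume_Icc, h8, ← ENNReal.ofReal_mul (by norm_num),
      ← ENNReal.ofReal_add (by positivity) (by positivity),
      ENNReal.ofReal_le_ofReal_iff (by positivity)] at h1
    linarith
  have hxyi : |x i - y i| ≤ ρ := by
    rw [← Real.dist_eq]
    exact dist_le_pi_dist x y i
  have hzx : |-x i + z| ≤ ρ := by
    rw [abs_le]
    constructor <;> linarith [hz.1, hz.2]
  have hzy : |-y i + z| ≤ 2 * ρ := by
    have := abs_le.1 hxyi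
    rw [abs_le]
    constructor <;> linarith [hz.1, hz.2]
  rw [mem_union, not_or] at hzT
  have hx1 : x + (-x i + z) • (Pi.single i 1 : ι → ℝ) ∈ A ∧
      ‖F (x + (-x i + z) • (Pi.single i 1 : ι → ℝ)) - F x‖ ≤ k * |-x i + z| := by
    by_contra hcon
    exact hzT.1 ⟨by linarith, hcon⟩
  have hy1 : y + (-y i + z) • (Pi.single i 1 : ι → ℝ) ∈ A ∧
      ‖F (y + (-y i + z) • (Pi.single i 1 : ι → ℝ)) - F y‖ ≤ k * |-y i + z| := by
    by_contra hcon
    exact hzT.2 ⟨by linarith, hcon⟩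
  set x' := x + (-x i + z) • (Pi.single i 1 : ι → ℝ) with hx'
  set y' := y + (-y i + z) • (Pi.single i 1 : ι → ℝ) with hy'
  have hx'i : x' i = z := by simp [hx']
  have hy'i : y' i = z := by simp [hy']
  have hx'j : ∀ j, j ≠ i → x' j = x j := fun j hj => by simp [hx', hj]
  have hy'j : ∀ j, j ≠ i → y' j = y j := fun j hj => by simp [hy', hj]
  have hd : dist x' y' ≤ ρ := by
    refine (dist_pi_le_iff dist_nonneg).2 fun j => ?_
    by_cases hj : j = i
    · rw [hj, hx'i, hy'i, dist_self]
      exact dist_nonneg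
    · rw [hx'j j hj, hy'j j hj]
      exact dist_le_pi_dist x y j
  have h1 : ‖F x' - F y'‖ ≤ M * dist x' y' := by
    refine h x' hx1.1 y' hy1.1 (fun j hj => ?_)
      (hd.trans_lt (hdist.trans_le (min_le_left _ _)))
    by_cases hji : j = i
    · rw [hji, hx'i, hy'i]
    · rw [hx'j j hji, hy'j j hji]
      exact hxy j (by simp [hji, hj])
  have hk0 : (0 : ℝ) ≤ k := Nat.cast_nonneg k
  calc ‖F x - F y‖ = ‖-(F x' - F x) + (F x' - F y') + (F y' - F y)‖ := by congr 1; abel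
    _ ≤ ‖F x' - F x‖ + ‖F x' - F y'‖ + ‖F y' - F y‖ := by
        refine norm_add₃_le.trans ?_
        rw [norm_neg]
    _ ≤ k * ρ + M * ρ + k * (2 * ρ) := by
        gcongr
        · exact hx1.2.trans (by gcongr)
        · exact h1.trans (by gcongr)
        · exact hy1.2.trans (by gcongr)
    _ = (M + 3 * k) * ρ := by ring

theorem exists_cover_locLipschitzAlong {ι V : Type*} [Fintype ι] [DecidableEq ι]
    [NormedAddCommGroup V] [MeasurableSpace V] [BorelSpace V] [SecondCountableTopology V]
    {F : (ι → ℝ) → V} (hF : Measurable F)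
    (hline : ∀ i, ∀ᵐ x : ι → ℝ, ∃ C : ℝ, ∀ᶠ t in 𝓝 (0 : ℝ),
      ‖F (x + t • (Pi.single i 1 : ι → ℝ)) - F x‖ ≤ C * |t|) (s : Finset ι) :
    ∃ (κ : Type) (_ : Countable κ) (A : κ → Set (ι → ℝ)), (∀ j, MeasurableSet (A j)) ∧
      (∀ j, LocLipschitzAlong F s (A j)) ∧ ∀ᵐ x, x ∈ ⋃ j, A j := by
  induction s using Finset.induction_on with
  | empty =>
    refine ⟨Unit, inferInstance, fun _ => univ, fun _ => MeasurableSet.univ, fun _ => ?_,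
      by simp⟩
    refine ⟨0, 1, le_rfl, one_pos, fun x _ y _ hxy _ => ?_⟩
    rw [funext fun i => hxy i (Finset.notMem_empty i)]
    simp
  | insert i s _ ih =>
    obtain ⟨κ, _, A, hAm, hAL, hA⟩ := ih
    refine ⟨κ × ℕ, inferInstance, fun p => lineGoodSet F (A p.1) (Pi.single i 1) p.2,
      fun p => measurableSet_lineGoodSet hF (hAm _) _ _,
      fun p => (hAL p.1).insert_lineGoodSet i p.2, ?_⟩
    filter_upwards [hA, ae_all_iff.2 fun j =>
      ae_mem_iUnion_lineGoodSet volume (hAm j) (Pi.single i 1) (hline i)] with x hx hx2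
    obtain ⟨j, hj⟩ := mem_iUnion.1 hx
    obtain ⟨k, hk⟩ := mem_iUnion.1 (hx2 j hj)
    exact mem_iUnion.2 ⟨(j, k), hk⟩

/-- A measurable function with partial derivatives almost everywhere is Lipschitz on each of
countably many measurable sets of finite measure which cover almost all of the space. -/
theorem exists_cover_lipschitzOnWith {ι V : Type*} [Fintype ι] [DecidableEq ι]
    [NormedAddCommGroup V] [MeasurableSpace V] [BorelSpace V] [SecondCountableTopology V]
    {F : (ι → ℝ) → V} (hF : Measurable F)
    (hline : ∀ i, ∀ᵐ x : ι → ℝ, ∃ C : ℝ, ∀ᶠ t in 𝓝 (0 : ℝ),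
      ‖F (x + t • (Pi.single i 1 : ι → ℝ)) - F x‖ ≤ C * |t|) :
    ∃ (κ : Type) (_ : Countable κ) (A : κ → Set (ι → ℝ)), (∀ j, MeasurableSet (A j)) ∧
      (∀ j, volume (A j) ≠ ∞) ∧ (∀ j, ∃ L, LipschitzOnWith L F (A j)) ∧ ∀ᵐ x, x ∈ ⋃ j, A j := by
  obtain ⟨κ, _, A, hAm, hAL, hA⟩ := exists_cover_locLipschitzAlong hF hline Finset.univ
  choose M r hM hr h using hAL
  refine ⟨κ × ℕ, inferInstance,
    fun p => A p.1 ∩ Metric.ball (TopologicalSpace.denseSeq (ι → ℝ) p.2) (r p.1 / 2),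
    fun p => (hAm _).inter measurableSet_ball,
    fun p => measure_ne_top_of_subset inter_subset_right measure_ball_lt_top.ne,
    fun p => ⟨(M p.1).toNNReal, LipschitzOnWith.of_dist_le_mul fun x hx y hy => ?_⟩, ?_⟩
  · rw [Real.coe_toNNReal _ (hM _), dist_eq_norm]
    refine h p.1 x hx.1 y hy.1 (by simp) ?_
    have h1 := Metric.mem_ball.1 hx.2
    have h2 := Metric.mem_ball'.1 hy.2
    linarith [dist_triangle x (TopologicalSpace.denseSeq (ι → ℝ) p.2) y]
  · filter_upwards [hA] with x hx
    obtain ⟨j, hj⟩ := mem_iUnion.1 hx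
    obtain ⟨k, hk⟩ := (TopologicalSpace.denseRange_denseSeq (ι → ℝ)).exists_dist_lt x
      (half_pos (hr j))
    exact mem_iUnion.2 ⟨(j, k), hj, hk⟩

section Smoothing

variable {E V : Type*} [NormedAddCommGroup E] [NormedSpace ℝ E] [FiniteDimensional ℝ E]
  [MeasurableSpace E] [BorelSpace E] [NormedAddCommGroup V] [NormedSpace ℝ V]

/-- The average of `f (x - t)` over `t`, weighted by a normed bump function. -/
noncomputable def bumpAverage (μ : Measure E) (b : ContDiffBump (0 : E)) (f : E → V) (x : E) : V :=
  ∫ t, b.normed μ t • f (x - t) ∂μ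

variable (μ : Measure E) [μ.IsAddHaarMeasure] (b : ContDiffBump (0 : E))

theorem integrable_normed_smul {h : E → V} (hh : Continuous h) :
    Integrable (fun t => b.normed μ t • h t) μ :=
  (b.continuous_normed.smul hh).integrable_of_hasCompactSupport
    b.hasCompactSupport_normed.smul_right

theorem normed_eq_zero_of_rOut_le {t : E} (ht : b.rOut ≤ ‖t‖) : b.normed μ t = 0 := by
  rw [← Function.notMem_support, b.support_normed_eq, Metric.mem_ball, dist_zero_right, not_lt]
  exact ht

theorem norm_integral_normed_smul_le {h : E → V} {c : ℝ}
    (hc : ∀ t, ‖t‖ ≤ b.rOut → ‖h t‖ ≤ c) : ‖∫ t, b.normed μ t • h t ∂μ‖ ≤ c := by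
  have hint : Integrable (fun t => b.normed μ t * c) μ := b.integrable_normed.mul_const c
  refine (norm_integral_le_of_norm_le hint (.of_forall fun t => ?_)).trans (le_of_eq ?_)
  · rw [norm_smul, Real.norm_of_nonneg (b.nonneg_normed t)]
    rcases le_total ‖t‖ b.rOut with ht | ht
    · exact mul_le_mul_of_nonneg_left (hc t ht) (b.nonneg_normed t)
    · simp [normed_eq_zero_of_rOut_le μ b ht]
  · rw [integral_mul_const, b.integral_normed, one_mul]

theorem integral_normed_smul_apply_eq_zero (A : E →L[ℝ] V) :
    ∫ t, b.normed μ t • A t ∂μ = 0 := by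
  have h := integral_neg_eq_self (fun t => b.normed μ t • A t) μ
  simp only [b.normed_neg, map_neg, smul_neg, integral_neg] at h
  have h2 : (2 : ℝ) • ∫ t, b.normed μ t • A t ∂μ = 0 := by
    rw [two_smul]
    exact add_eq_zero_iff_neg_eq.2 h
  exact (smul_eq_zero.1 h2).resolve_left two_ne_zero

theorem contDiff_bumpAverage {f : E → V} (hf : Continuous f) : ContDiff ℝ 1 (bumpAverage μ b f) :=
  b.hasCompactSupport_normed.contDiff_convolution_left (n := 1) (μ := μ)
    (ContinuousLinearMap.lsmul ℝ ℝ) b.contDiff_normed hf.locallyIntegrable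

theorem lipschitzWith_bumpAverage {L : ℝ≥0} {f : E → V} (hf : LipschitzWith L f) :
    LipschitzWith L (bumpAverage μ b f) := by
  have hc := hf.continuous
  refine LipschitzWith.of_dist_le_mul fun x y => ?_
  rw [dist_eq_norm, bumpAverage, bumpAverage, ← integral_sub
    (integrable_normed_smul μ b (by fun_prop)) (integrable_normed_smul μ b (by fun_prop))]
  simp only [← smul_sub]
  refine norm_integral_normed_smul_le μ b fun t _ => ?_
  rw [← dist_eq_norm]
  exact (hf.dist_le_mul _ _).trans_eq (by rw [dist_sub_right])

variable [CompleteSpace V]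

/-- Averaging reproduces affine functions. -/
theorem integral_normed_smul_sub_affine {f : E → V} (hf : Continuous f) (A : E →L[ℝ] V) (x y : E) :
    ∫ t, b.normed μ t • (f (y - t) - f x - A (y - t - x)) ∂μ
      = bumpAverage μ b f y - f x - A (y - x) := by
  have h1 : ∀ t, b.normed μ t • (f (y - t) - f x - A (y - t - x))
      = b.normed μ t • f (y - t) - b.normed μ t • (f x + A (y - x)) + b.normed μ t • A t := by
    intro t
    rw [show y - t - x = (y - x) - t by abel, map_sub, ← smul_sub, ← smul_add]
    congr 1
    abel
  simp only [h1]
  rw [integral_add, integral_sub, integral_normed_smul_apply_eq_zero, integral_smul_const,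
    b.integral_normed, one_smul, add_zero, bumpAverage, sub_sub]
  · exact integrable_normed_smul μ b (by fun_prop)
  · exact b.integrable_normed.smul_const _
  · exact (integrable_normed_smul μ b (by fun_prop)).sub (b.integrable_normed.smul_const _)
  · exact integrable_normed_smul μ b (by fun_prop)

theorem norm_bumpAverage_sub_le {f : E → V} (hf : Continuous f) (A : E →L[ℝ] V) {x : E} {c : ℝ}
    (hc : ∀ z, ‖z - x‖ ≤ b.rOut → ‖f z - f x - A (z - x)‖ ≤ c) :
    ‖bumpAverage μ b f x - f x‖ ≤ c := by
  have h := integral_normed_smul_sub_affine μ b hf A x x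
  rw [sub_self, map_zero, sub_zero] at h
  rw [← h]
  refine norm_integral_normed_smul_le μ b fun t ht => hc _ ?_
  simpa using ht

theorem norm_bumpAverage_sub_sub_le {M : ℝ≥0} (hM : LipschitzWith M (b.normed μ)) {f : E → V}
    (hf : Continuous f) (A : E →L[ℝ] V) {x y : E} {c : ℝ} (hxy : ‖y - x‖ ≤ b.rOut)
    (hc : ∀ z, ‖z - x‖ ≤ 2 * b.rOut → ‖f z - f x - A (z - x)‖ ≤ c) :
    ‖bumpAverage μ b f y - bumpAverage μ b f x - A (y - x)‖
      ≤ M * ‖y - x‖ * c * μ.real (Metric.closedBall 0 (2 * b.rOut)) := by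
  have : ProperSpace E := FiniteDimensional.proper ℝ E
  set h : E → V := fun z => f z - f x - A (z - x) with hh
  have hhc : Continuous h := by fun_prop
  have hsub : ∀ w, ∫ z, b.normed μ (w - z) • h z ∂μ = bumpAverage μ b f w - f x - A (w - x) := by
    intro w
    rw [← integral_normed_smul_sub_affine μ b hf A x w,
      ← integral_sub_left_eq_self (fun t => b.normed μ t • (f (w - t) - f x - A (w - t - x))) μ w]
    simp [hh]
  have hint : ∀ w, Integrable (fun z => b.normed μ (w - z) • h z) μ := by
    intro w
    have := (integrable_normed_smul μ b (h := fun t => h (w - t)) (by fun_prop)).comp_sub_left w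
    simpa using this
  have heq : bumpAverage μ b f y - bumpAverage μ b f x - A (y - x)
      = ∫ z, (b.normed μ (y - z) - b.normed μ (x - z)) • h z ∂μ := by
    simp only [sub_smul]
    rw [integral_sub (hint y) (hint x), hsub, hsub]
    simp
    abel
  have hzero : ∀ z, z ∉ Metric.closedBall x (2 * b.rOut) →
      (b.normed μ (y - z) - b.normed μ (x - z)) • h z = 0 := by
    intro z hz
    rw [Metric.mem_closedBall, not_le, dist_comm, dist_eq_norm] at hz
    have h1 : b.rOut ≤ ‖x - z‖ := by linarith [b.rOut_pos]
    have h2 : b.rOut ≤ ‖y - z‖ := by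
      have : ‖x - z‖ ≤ ‖y - z‖ + ‖y - x‖ := by
        rw [show x - z = (y - z) - (y - x) by abel]
        exact norm_sub_le _ _
      linarith
    rw [normed_eq_zero_of_rOut_le μ b h1, normed_eq_zero_of_rOut_le μ b h2, sub_zero, zero_smul]
  rw [heq, ← setIntegral_eq_integral_of_forall_compl_eq_zero hzero]
  refine (norm_setIntegral_le_of_norm_le_const measure_closedBall_lt_top
    (C := M * ‖y - x‖ * c) fun z hz => ?_).trans_eq ?_
  · rw [norm_smul]
    gcongr
    · rw [← dist_eq_norm]
      refine (hM.dist_le_mul _ _).trans_eq ?_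
      rw [dist_sub_right, dist_eq_norm]
    · refine hc z ?_
      rwa [← dist_eq_norm]
  · rw [measureReal_def, measureReal_def, Measure.addHaar_closedBall_center]

end Smoothing

/-- Smoothing at unit scale: the error has a small Lipschitz constant on sets where the function
is close to affine. -/
theorem exists_smoothing_unit_scale {E V : Type*} [NormedAddCommGroup E]
    [NormedSpace ℝ E] [FiniteDimensional ℝ E] [NormedAddCommGroup V] [NormedSpace ℝ V]
    [CompleteSpace V] : ∃ C : ℝ, 0 ≤ C ∧ ∀ (L : ℝ≥0) (f : E → V),
    LipschitzWith L f → ∃ g : E → V, ContDiff ℝ 1 g ∧ LipschitzWith L g ∧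
      (∀ x, ‖g x - f x‖ ≤ L) ∧ ∀ (η : ℝ) (K : Set E), 0 ≤ η →
        (∀ x ∈ K, ∃ A : E →L[ℝ] V, ∀ z, ‖z - x‖ ≤ 2 → ‖f z - f x - A (z - x)‖ ≤ η * ‖z - x‖) →
        ∀ x ∈ K, ∀ y ∈ K, ‖(f y - g y) - (f x - g x)‖ ≤ C * η * ‖y - x‖ := by
  borelize E
  let μ : Measure E := Measure.addHaar
  let b : ContDiffBump (0 : E) := ⟨1 / 2, 1, by norm_num, by norm_num⟩
  have hb : b.rOut = 1 := rfl
  obtain ⟨M, hM⟩ := ContDiff.lipschitzWith_of_hasCompactSupport (𝕂 := ℝ)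
    (b.hasCompactSupport_normed (μ := μ)) (b.contDiff_normed (n := 1)) one_ne_zero
  set c := μ.real (Metric.closedBall (0 : E) (2 * b.rOut)) with hc
  have hc0 : 0 ≤ c := measureReal_nonneg
  refine ⟨2 * M * c + 2, by positivity, fun L f hf => ⟨bumpAverage μ b f,
    contDiff_bumpAverage μ b hf.continuous, lipschitzWith_bumpAverage μ b hf, fun x => ?_, ?_⟩⟩
  · refine norm_bumpAverage_sub_le μ b hf.continuous 0 fun z hz => ?_
    rw [zero_apply, sub_zero, ← dist_eq_norm]
    refine (hf.dist_le_mul _ _).trans ?_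
    rw [dist_eq_norm]
    exact mul_le_of_le_one_right L.2 hz
  · intro η K hη hK x hx y hy
    obtain ⟨A, hA⟩ := hK x hx
    rcases le_total ‖y - x‖ 1 with hxy | hxy
    · have h1 := norm_bumpAverage_sub_sub_le μ b hM hf.continuous A (x := x) (y := y)
        (c := η * 2) hxy fun z hz => (hA z (by rw [hb] at hz; linarith)).trans (by
          rw [hb] at hz
          gcongr
          linarith)
      have h2 := hA y (by linarith)
      calc _ = ‖(f y - f x - A (y - x))
            - (bumpAverage μ b f y - bumpAverage μ b f x - A (y - x))‖ := by congr 1; abel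
        _ ≤ η * ‖y - x‖ + M * ‖y - x‖ * (η * 2) * c := (norm_sub_le _ _).trans (add_le_add h2 h1)
        _ ≤ (2 * M * c + 2) * η * ‖y - x‖ := by
          have : 0 ≤ η * ‖y - x‖ := by positivity
          linarith
    · have h : ∀ w ∈ K, ‖bumpAverage μ b f w - f w‖ ≤ η := by
        intro w hw
        obtain ⟨A, hA⟩ := hK w hw
        refine norm_bumpAverage_sub_le μ b hf.continuous A fun z hz => ?_
        rw [hb] at hz
        exact (hA z (by linarith)).trans (mul_le_of_le_one_right hη hz)
      calc _ = ‖(bumpAverage μ b f x - f x) - (bumpAverage μ b f y - f y)‖ := by congr 1; abel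
        _ ≤ η + η := (norm_sub_le _ _).trans (add_le_add (h x hx) (h y hy))
        _ = 2 * η * 1 := by ring
        _ ≤ (2 * M * c + 2) * η * ‖y - x‖ := by
          gcongr
          have : 0 ≤ 2 * M * c := by positivity
          linarith

/-- Smoothing at scale `δ`, with an error bound independent of `δ`. -/
theorem exists_smoothing {E V : Type*} [NormedAddCommGroup E]
    [NormedSpace ℝ E] [FiniteDimensional ℝ E] [NormedAddCommGroup V] [NormedSpace ℝ V]
    [CompleteSpace V] : ∃ C : ℝ, 0 ≤ C ∧ ∀ (L : ℝ≥0) (f : E → V) (δ : ℝ), 0 < δ →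
    LipschitzWith L f → ∃ g : E → V, ContDiff ℝ 1 g ∧ LipschitzWith L g ∧
      (∀ x, ‖g x - f x‖ ≤ L * δ) ∧ ∀ (η : ℝ) (K : Set E), 0 ≤ η →
        (∀ x ∈ K, ∃ A : E →L[ℝ] V, ∀ z, ‖z - x‖ ≤ 2 * δ →
          ‖f z - f x - A (z - x)‖ ≤ η * ‖z - x‖) →
        ∀ x ∈ K, ∀ y ∈ K, ‖(f y - g y) - (f x - g x)‖ ≤ C * η * ‖y - x‖ := by
  obtain ⟨C, hC, h⟩ := exists_smoothing_unit_scale (E := E) (V := V)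
  refine ⟨C, hC, fun L f δ hδ hf => ?_⟩
  have hδ' := hδ.ne'
  have hnorm : ∀ v : E, ‖δ⁻¹ • v‖ = δ⁻¹ * ‖v‖ := fun v => by
    rw [norm_smul, Real.norm_of_nonneg (by positivity)]
  have hnorm' : ∀ v : V, ‖δ • v‖ = δ * ‖v‖ := fun v => by
    rw [norm_smul, Real.norm_of_nonneg hδ.le]
  obtain ⟨g, hg1, hgL, hgf, hg⟩ := h L (fun z => δ⁻¹ • f (δ • z)) (by
    refine LipschitzWith.of_dist_le_mul fun x y => ?_
    rw [dist_smul₀, Real.norm_of_nonneg (by positivity), inv_mul_le_iff₀ hδ]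
    refine (hf.dist_le_mul _ _).trans_eq ?_
    rw [dist_smul₀, Real.norm_of_nonneg hδ.le]
    ring)
  have key : ∀ x, δ • g (δ⁻¹ • x) - f x = δ • (g (δ⁻¹ • x) - δ⁻¹ • f (δ • δ⁻¹ • x)) := by
    intro x
    rw [smul_sub, smul_inv_smul₀ hδ', smul_inv_smul₀ hδ']
  refine ⟨fun x => δ • g (δ⁻¹ • x), by fun_prop, ?_, fun x => ?_, ?_⟩
  · refine LipschitzWith.of_dist_le_mul fun x y => ?_
    rw [dist_smul₀, Real.norm_of_nonneg hδ.le]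
    calc δ * dist (g (δ⁻¹ • x)) (g (δ⁻¹ • y)) ≤ δ * (L * dist (δ⁻¹ • x) (δ⁻¹ • y)) := by
          gcongr
          exact hgL.dist_le_mul _ _
      _ = L * dist x y := by
          rw [dist_smul₀, Real.norm_of_nonneg (by positivity)]
          field_simp
  · rw [key, hnorm', mul_comm]
    gcongr
    exact hgf _
  · intro η K hη hK x hx y hy
    have h1 := hg η ((fun z => δ • z) ⁻¹' K) hη (fun w hw => by
      obtain ⟨A, hA⟩ := hK (δ • w) hw
      refine ⟨A, fun z hz => ?_⟩
      have h2 : ‖δ • z - δ • w‖ = δ * ‖z - w‖ := by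
        rw [← smul_sub, norm_smul, Real.norm_of_nonneg hδ.le]
      have h3 := hA (δ • z) (by rw [h2]; nlinarith)
      have h4 : δ⁻¹ • f (δ • z) - δ⁻¹ • f (δ • w) - A (z - w)
          = δ⁻¹ • (f (δ • z) - f (δ • w) - A (δ • z - δ • w)) := by
        rw [← smul_sub δ z w, map_smul, smul_sub, smul_sub, inv_smul_smul₀ hδ']
      rw [h4, norm_smul, Real.norm_of_nonneg (by positivity), inv_mul_le_iff₀ hδ]
      refine h3.trans_eq ?_
      rw [h2]
      ring) (δ⁻¹ • x) (by simpa [smul_inv_smul₀ hδ'] using hx) (δ⁻¹ • y)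
        (by simpa [smul_inv_smul₀ hδ'] using hy)
    have h5 : (f y - δ • g (δ⁻¹ • y)) - (f x - δ • g (δ⁻¹ • x))
        = δ • ((δ⁻¹ • f (δ • δ⁻¹ • y) - g (δ⁻¹ • y))
          - (δ⁻¹ • f (δ • δ⁻¹ • x) - g (δ⁻¹ • x))) := by
      rw [smul_sub, smul_sub, smul_sub, smul_inv_smul₀ hδ', smul_inv_smul₀ hδ',
        smul_inv_smul₀ hδ', smul_inv_smul₀ hδ']
    rw [h5, hnorm']
    calc _ ≤ δ * (C * η * ‖δ⁻¹ • y - δ⁻¹ • x‖) := by gcongr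
      _ = C * η * ‖y - x‖ := by
        rw [← smul_sub, hnorm]
        field_simp

theorem measure_sdiff_differentiable_lt {E V : Type*} [NormedAddCommGroup E] [NormedSpace ℝ E]
    [FiniteDimensional ℝ E] [MeasurableSpace E] [BorelSpace E] [NormedAddCommGroup V]
    [NormedSpace ℝ V] [FiniteDimensional ℝ V] (μ : Measure E) {f : E → V} (hf : Continuous f)
    (hdiff : ∀ᵐ x ∂μ, DifferentiableAt ℝ f x) {B : Set E} (hB : MeasurableSet B) (hBμ : μ B ≠ ∞)
    {η : ℝ} (hη : 0 < η) {ε : ℝ≥0∞} (hε : 0 < ε) :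
    ∃ K, MeasurableSet K ∧ μ (B \ K) < ε ∧ ∃ r > 0, ∀ x ∈ K, ∃ A : E →L[ℝ] V,
      ∀ z, ‖z - x‖ < r → ‖f z - f x - A (z - x)‖ ≤ η * ‖z - x‖ := by
  have : ProperSpace E := FiniteDimensional.proper ℝ E
  have : ProperSpace V := FiniteDimensional.proper ℝ V
  have : CompleteSpace V := FiniteDimensional.complete ℝ V
  borelize V
  set u := TopologicalSpace.denseSeq E with hu
  set S : ℕ → Set E := fun k => {x | ∀ n, ‖u n‖ < 1 / (k + 1) →
    ‖f (x + u n) - f x - fderiv ℝ f x (u n)‖ ≤ η * ‖u n‖} with hS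
  have hSm : ∀ k, MeasurableSet (S k) := fun k => by
    simp only [hS, ofPred_forall]
    refine MeasurableSet.iInter fun n => MeasurableSet.iInter fun _ => ?_
    have h1 : Measurable fun x => ‖f (x + u n) - f x - fderiv ℝ f x (u n)‖ :=
      ((by fun_prop : Continuous fun x => f (x + u n) - f x).measurable.sub
        (measurable_fderiv_apply_const ℝ f (u n))).norm
    exact measurableSet_le h1 measurable_const
  have hmono : Monotone S := fun k l hkl x hx n hn =>
    hx n (hn.trans_le (Nat.one_div_le_one_div hkl))
  have hnull : μ (⋂ k, B \ S k) = 0 := by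
    refine measure_mono_null (t := {x | ¬ DifferentiableAt ℝ f x}) (fun x hx hxd => ?_) hdiff
    have h1 := hxd.hasFDerivAt.isLittleO.def hη
    obtain ⟨δ, hδ, hδx⟩ := Metric.eventually_nhds_iff.1 h1
    obtain ⟨k, hk⟩ := exists_nat_one_div_lt hδ
    refine (mem_iInter.1 hx k).2 fun n hn => ?_
    have h2 := hδx (y := x + u n) (by simpa [dist_eq_norm] using hn.trans (by simpa using hk))
    simpa using h2
  have htend := tendsto_measure_iInter_atTop (μ := μ) (s := fun k => B \ S k)
    (fun k => (hB.diff (hSm k)).nullMeasurableSet)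
    (fun k l hkl => sdiff_subset_sdiff_right (hmono hkl))
    ⟨0, measure_ne_top_of_subset sdiff_subset hBμ⟩
  rw [hnull] at htend
  obtain ⟨k, hk⟩ := (htend.eventually (gt_mem_nhds hε)).exists
  refine ⟨S k, hSm k, hk, 1 / (k + 1), by positivity, fun x hx => ⟨fderiv ℝ f x, fun z hz => ?_⟩⟩
  set D : Set E := {v | ‖f (x + v) - f x - fderiv ℝ f x v‖ ≤ η * ‖v‖} with hD
  have hDc : IsClosed D := isClosed_le (by fun_prop) (by fun_prop)
  have hzD : z - x ∈ D := by
    refine closure_minimal ?_ hDc ((TopologicalSpace.denseRange_denseSeq E).open_subset_closure_inter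
      (Metric.isOpen_ball (x := (0 : E)) (ε := 1 / (k + 1))) (by simpa using hz))
    rintro _ ⟨hv, n, rfl⟩
    exact hx n (by simpa using hv)
  simpa [hD] using hzD

/-- A Lipschitz function is the sum of a `C¹` function with the same Lipschitz constant and a
function which, outside a set of small measure, has a small Lipschitz constant. -/
theorem LipschitzWith.exists_contDiff_lipschitzOnWith_sub {E V : Type*} [NormedAddCommGroup E]
    [NormedSpace ℝ E] [FiniteDimensional ℝ E] [MeasurableSpace E] [BorelSpace E]
    [NormedAddCommGroup V] [NormedSpace ℝ V] [FiniteDimensional ℝ V] (μ : Measure E)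
    [μ.IsAddHaarMeasure] {L : ℝ≥0} {f : E → V} (hf : LipschitzWith L f) {B : Set E}
    (hB : MeasurableSet B) (hBμ : μ B ≠ ∞) {η : ℝ≥0} (hη : 0 < η) {ε : ℝ≥0∞} (hε : 0 < ε) :
    ∃ (g : E → V) (K : Set E), ContDiff ℝ 1 g ∧ LipschitzWith L g ∧ (∀ x, ‖g x - f x‖ ≤ η) ∧
      μ (B \ K) < ε ∧ LipschitzOnWith η (f - g) K := by
  have : CompleteSpace V := FiniteDimensional.complete ℝ V
  obtain ⟨C, hC, h⟩ := exists_smoothing (E := E) (V := V)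
  have hη' : (0 : ℝ) < η := hη
  obtain ⟨K, -, hKμ, r, hr, hKr⟩ := measure_sdiff_differentiable_lt μ hf.continuous
    (hf.ae_differentiableAt (μ := μ)) hB hBμ (show 0 < (η : ℝ) / (C + 1) by positivity) hε
  have hδ : 0 < min (r / 3) (η / (L + 1)) := by positivity
  obtain ⟨g, hg, hgL, hgf, hgK⟩ := h L f _ hδ hf
  refine ⟨g, K, hg, hgL, fun x => (hgf x).trans ?_, hKμ, ?_⟩
  · calc (L : ℝ) * min (r / 3) (η / (L + 1)) ≤ (L + 1) * (η / (L + 1)) := by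
          gcongr
          · linarith
          · exact min_le_right _ _
      _ = η := by field_simp
  · refine LipschitzOnWith.of_dist_le_mul fun y hy x hx => ?_
    rw [dist_eq_norm, dist_eq_norm]
    refine (hgK (η / (C + 1)) K (by positivity) (fun w hw => ?_) x hx y hy).trans ?_
    · obtain ⟨A, hA⟩ := hKr w hw
      refine ⟨A, fun z hz => hA z (hz.trans_lt ?_)⟩
      linarith [min_le_left (r / 3) (η / (L + 1) : ℝ)]
    · gcongr
      rw [← mul_div_assoc, div_le_iff₀ (by positivity)]
      nlinarith

/-- A Lipschitz function agrees with a `C¹` function outside a set of small measure. -/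
theorem LipschitzWith.exists_contDiff_measure_inter_ne_lt {E ι : Type*} [NormedAddCommGroup E]
    [NormedSpace ℝ E] [FiniteDimensional ℝ E] [MeasurableSpace E] [BorelSpace E] [Fintype ι]
    (μ : Measure E) [μ.IsAddHaarMeasure] {L : ℝ≥0} {f : E → ι → ℝ} (hf : LipschitzWith L f)
    {B : Set E} (hB : MeasurableSet B) (hBμ : μ B ≠ ∞) {ε : ℝ≥0∞} (hε : ε ≠ 0) :
    ∃ g : E → ι → ℝ, ContDiff ℝ 1 g ∧ μ (B ∩ {x | f x ≠ g x}) < ε := by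
  obtain ⟨ε', hε'0, hε'⟩ := ENNReal.exists_pos_sum_of_countable' hε ℕ
  set η : ℕ → ℝ≥0 := fun k => (L + 1) * (1 / 2) ^ k with hη
  have hη0 : ∀ k, 0 < η k := fun k => by positivity
  have hηs : Summable fun k => (η k : ℝ) := by
    simp only [hη, NNReal.coe_mul, NNReal.coe_pow]
    exact (summable_geometric_of_lt_one (by positivity) (by
      simp only [one_div, NNReal.coe_inv, NNReal.coe_ofNat]; norm_num)).mul_left _
  have step : ∀ (k : ℕ) (φ : {φ : E → ι → ℝ // LipschitzWith (η k) φ}),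
      ∃ (ψ : {φ : E → ι → ℝ // LipschitzWith (η (k + 1)) φ}) (g : E → ι → ℝ) (K : Set E),
        ContDiff ℝ 1 g ∧ LipschitzWith (η k) g ∧ (∀ x, ‖g x - φ.1 x‖ ≤ η (k + 1)) ∧
        μ (B \ K) < ε' k ∧ EqOn (φ.1 - g) ψ.1 K := by
    intro k φ
    obtain ⟨g, K, hg, hgL, hgφ, hK, hLK⟩ :=
      φ.2.exists_contDiff_lipschitzOnWith_sub μ hB hBμ (hη0 (k + 1)) (hε'0 k)
    obtain ⟨ψ, hψ, hψK⟩ := hLK.extend_pi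
    exact ⟨⟨ψ, hψ⟩, g, K, hg, hgL, hgφ, hK, hψK⟩
  choose rem g K hg hgL hgφ hK hrem using step
  let φ : ∀ k, {φ : E → ι → ℝ // LipschitzWith (η k) φ} := fun k =>
    Nat.rec ⟨f, hf.weaken (by simp [hη])⟩ (fun k φ => rem k φ) k
  have hφ : ∀ k, φ (k + 1) = rem k (φ k) := fun k => rfl
  have hφ0 : (φ 0).1 = f := rfl
  set K' : Set E := ⋂ k, K k (φ k) with hK'
  have hBK' : μ (B \ K') < ε := by
    rw [hK', sdiff_iInter]
    refine (measure_iUnion_le _).trans_lt (lt_of_le_of_lt ?_ hε')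
    exact ENNReal.tsum_le_tsum fun k => (hK k (φ k)).le
  have hrec : ∀ x ∈ K', ∀ k, (φ (k + 1)).1 x = (φ k).1 x - g k (φ k) x := fun x hx k => by
    rw [hφ]
    exact (hrem k (φ k) (mem_iInter.1 hx k)).symm
  have hsmall : ∀ x ∈ K', ∀ k, ‖(φ (k + 1)).1 x‖ ≤ η (k + 1) := fun x hx k => by
    rw [hrec x hx k, norm_sub_rev]
    exact hgφ k (φ k) x
  have hsum : ∀ x ∈ K', HasSum (fun k => g k (φ k) x) (f x) := by
    intro x hx
    have htend : Tendsto (fun k => (φ k).1 x) atTop (𝓝 0) := by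
      rw [← tendsto_add_atTop_iff_nat 1]
      exact squeeze_zero_norm (hsmall x hx)
        ((tendsto_add_atTop_iff_nat 1).2 hηs.tendsto_atTop_zero)
    have hnorm : Summable fun k => g k (φ k) x := by
      refine (summable_nat_add_iff 1).1 (Summable.of_norm_bounded
        (((summable_nat_add_iff 1).2 hηs).add ((summable_nat_add_iff 2).2 hηs)) fun k => ?_)
      have h1 : g (k + 1) (φ (k + 1)) x = (φ (k + 1)).1 x - (φ (k + 2)).1 x := by
        rw [hrec x hx (k + 1)]
        abel
      rw [h1]
      exact (_root_.norm_sub_le _ _).trans (add_le_add (hsmall x hx k) (hsmall x hx (k + 1)))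
    rw [hnorm.hasSum_iff_tendsto_nat]
    have hpart : ∀ k, ∑ j ∈ Finset.range k, g j (φ j) x = f x - (φ k).1 x := by
      intro k
      induction k with
      | zero => simp [hφ0]
      | succ k ih =>
        rw [Finset.sum_range_succ, ih, hrec x hx k]
        abel
    simp only [hpart]
    simpa using htend.const_sub (f x)
  rcases K'.eq_empty_or_nonempty with hempty | ⟨x₀, hx₀⟩
  · refine ⟨0, contDiff_const, (measure_mono inter_subset_left).trans_lt ?_⟩
    simpa [hempty] using hBK'
  refine ⟨fun x => ∑' k, g k (φ k) x, ?_, (measure_mono ?_).trans_lt hBK'⟩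
  · have hder : ∀ k x, HasFDerivAt (g k (φ k)) (fderiv ℝ (g k (φ k)) x) x := fun k x =>
      ((hg k (φ k)).differentiable one_ne_zero x).hasFDerivAt
    have hbound : ∀ k x, ‖fderiv ℝ (g k (φ k)) x‖ ≤ η k := fun k x =>
      norm_fderiv_le_of_lipschitz ℝ (hgL k (φ k))
    exact contDiff_one_iff_hasFDerivAt.2 ⟨_,
      continuous_tsum (fun k => (hg k (φ k)).continuous_fderiv one_ne_zero) hηs hbound,
      hasFDerivAt_tsum hηs hder hbound (hsum x₀ hx₀).summable⟩
  · rintro x ⟨hxB, hx⟩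
    exact ⟨hxB, fun hxK => hx (hsum x hxK).tsum_eq.symm⟩

/-- A measurable function which is Lipschitz on countably many sets covering almost all of the
space agrees with a `C¹` function outside a set of small measure. -/
theorem exists_contDiff_measure_ne_lt_of_lipschitzOnWith {E ι κ : Type*} [NormedAddCommGroup E]
    [NormedSpace ℝ E] [FiniteDimensional ℝ E] [MeasurableSpace E] [BorelSpace E] [Fintype ι]
    [Countable κ] (μ : Measure E) [μ.IsAddHaarMeasure] {F : E → ι → ℝ} {A : κ → Set E}
    (hA : ∀ j, MeasurableSet (A j)) (hfin : ∀ j, μ (A j) ≠ ∞)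
    (hL : ∀ j, ∃ L, LipschitzOnWith L F (A j)) (hcover : ∀ᵐ x ∂μ, x ∈ ⋃ j, A j)
    {ε : ℝ≥0∞} (hε : ε ≠ 0) :
    ∃ f : E → ι → ℝ, ContDiff ℝ 1 f ∧ μ {x | F x ≠ f x} < ε := by
  choose L hL using hL
  choose f hf hFf using fun j => (hL j).extend_pi
  choose g hg hgμ using fun (j : κ) (k : ℕ) =>
    (hf j).exists_contDiff_measure_inter_ne_lt μ (hA j) (hfin j)
      (ε := (k + 1 : ℝ≥0∞)⁻¹) (by simp)
  have hclosed : ∀ j k, IsClosed {x | f j x = g j k x} := fun j k =>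
    isClosed_eq (hf j).continuous (hg j k).continuous
  refine exists_contDiff_measure_ne_lt_of_iUnion μ (A := fun p : κ × ℕ =>
    A p.1 ∩ {x | f p.1 x = g p.1 p.2 x}) (fun p => (hA _).inter (hclosed _ _).measurableSet)
    (fun p => measure_ne_top_of_subset inter_subset_left (hfin _)) ?_
    (fun p => ⟨g p.1 p.2, hg _ _, fun x hx => (hFf p.1 hx.1).trans hx.2⟩) hε
  have hnull : ∀ j, μ (⋂ k, A j ∩ {x | f j x ≠ g j k x}) = 0 := by
    intro j
    by_contra h
    obtain ⟨k, hk⟩ := ENNReal.exists_inv_nat_lt h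
    refine lt_irrefl _ (hk.trans_le ((measure_mono (iInter_subset _ k)).trans ?_))
    refine (hgμ j k).le.trans ?_
    gcongr
    exact le_self_add
  filter_upwards [hcover, ae_all_iff.2 fun j => measure_eq_zero_iff_ae_notMem.1 (hnull j)]
    with x hx hx2
  obtain ⟨j, hj⟩ := mem_iUnion.1 hx
  have h := hx2 j
  simp only [mem_iInter, not_forall] at h
  obtain ⟨k, hk⟩ := h
  refine mem_iUnion.2 ⟨(j, k), hj, ?_⟩
  by_contra hne
  exact hk ⟨hj, hne⟩

/-- Two functions which are differentiable at `x` along a line have the same derivative there for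
almost every `x` at which they agree. -/
theorem ae_lineDeriv_eq_of_eq {E V : Type*} [NormedAddCommGroup E] [NormedSpace ℝ E]
    [FiniteDimensional ℝ E] [MeasurableSpace E] [BorelSpace E] [NormedAddCommGroup V]
    [NormedSpace ℝ V] (μ : Measure E) [μ.IsAddHaarMeasure] {F f : E → V}
    (hFf : MeasurableSet {x | F x = f x}) (v : E) :
    ∀ᵐ x ∂μ, F x = f x → ∀ a b : V, HasLineDerivAt ℝ F a x v → HasLineDerivAt ℝ f b x v →
      a = b := by
  filter_upwards [ae_forall_volume_line_notMem_le μ hFf v one_ne_zero] with x hx hxF a b ha hb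
  obtain ⟨k, hk⟩ := hx hxF
  by_contra hab
  have h1 : ∀ᶠ t in 𝓝[≠] (0 : ℝ), F (x + t • v) - f (x + t • v) ≠ 0 :=
    (HasDerivAt.sub ha hb).eventually_ne (sub_ne_zero.2 hab)
  rw [eventually_nhdsWithin_iff] at h1
  obtain ⟨δ, hδ, hδt⟩ := Metric.eventually_nhds_iff.1 h1
  obtain ⟨q, hq0, hq⟩ := exists_rat_btwn (show 0 < min δ (1 / ((k : ℝ) + 1)) by positivity)
  have hq0' : 0 < q := by exact_mod_cast hq0
  have h2 := hk q hq0' (hq.trans_le (min_le_right _ _))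
  have h3 : Icc (-(q : ℝ)) q \ {0} ⊆ {t : ℝ | |t| ≤ q ∧ x + t • v ∉ {x | F x = f x}} := by
    rintro t ⟨ht, ht0⟩
    have htq := abs_le.2 ht
    refine ⟨htq, fun h => hδt (y := t) ?_ ht0 (sub_eq_zero.2 h)⟩
    rw [Real.dist_eq, sub_zero]
    exact htq.trans_lt (hq.trans_le (min_le_left _ _))
  have h4 := (measure_mono h3).trans h2
  rw [measure_sdiff_null (by simp), Real.volume_Icc, one_mul,
    ENNReal.ofReal_le_ofReal_iff hq0.le] at h4
  linarith

/-- Lusin-type `C¹`-approximation (Federer): if `F : ℝ^m → ℝ^n` is measurable and at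
`λ^m`-a.e. point all `m` coordinate partial derivatives exist (collected in the matrix
`G x`, whose `i`-th column is the derivative at `t = 0` of `t ↦ F (x + t • e i)`), then
for every `ε > 0` there is `F_ε ∈ C¹(ℝ^m, ℝ^n)` with
`λ^m ({F ≠ F_ε} ∪ {G ≠ DF_ε}) < ε`. -/
theorem stmt5 (m n : ℕ) (F : (Fin m → ℝ) → (Fin n → ℝ)) (hF : Measurable F)
    (G : (Fin m → ℝ) → Matrix (Fin n) (Fin m) ℝ)
    (hdiff : ∀ᵐ x : Fin m → ℝ ∂volume, ∀ i : Fin m,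
      HasDerivAt (fun t : ℝ => F (x + t • (Pi.single i 1 : Fin m → ℝ))) (fun j => G x j i) 0) :
    ∀ ε : ℝ, 0 < ε → ∃ Fε : (Fin m → ℝ) → (Fin n → ℝ), ContDiff ℝ 1 Fε ∧
      volume ({x | F x ≠ Fε x} ∪
          {x | G x ≠ Matrix.of fun j i => fderiv ℝ Fε x (Pi.single i 1 : Fin m → ℝ) j})
        < ENNReal.ofReal ε := by
  intro ε hε
  obtain ⟨κ, _, A, hAm, hAfin, hAL, hA⟩ := exists_cover_lipschitzOnWith hF fun i => by
    filter_upwards [hdiff] with x hx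
    obtain ⟨C, hC⟩ := (hx i).isBigO_sub.bound
    refine ⟨C, hC.mono fun t ht => ?_⟩
    simpa using ht
  obtain ⟨f, hf, hfμ⟩ := exists_contDiff_measure_ne_lt_of_lipschitzOnWith volume hAm hAfin hAL hA
    (ENNReal.ofReal_pos.2 hε).ne'
  refine ⟨f, hf, lt_of_le_of_lt (measure_mono_ae ?_) hfμ⟩
  filter_upwards [hdiff, ae_all_iff.2 fun i => ae_lineDeriv_eq_of_eq volume
    (measurableSet_eq_fun hF hf.continuous.measurable) (Pi.single i 1 : Fin m → ℝ)] with x hx hline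
  rintro (h | h)
  · exact h
  · intro hFf
    refine h (Matrix.ext fun j i => ?_)
    exact congrFun (hline i hFf _ _ (hx i)
      ((hf.differentiable one_ne_zero x).hasFDerivAt.hasLineDerivAt _)) j
end

section
/- Let F : ℝ^m → ℝ^m be Lebesgue measurable and suppose that at λ^m-almost every point x ∈ ℝ^m all m partial derivatives of F in the coordinate directions exist; let G : ℝ^m → ℝ^{m×m} denote the almost-everywhere defined matrix of these partial derivatives, and let N = {x : all partial derivatives of F exist at x and det G(x) ≠ 0}. Then the pushforward under F of the restriction of λ^m to N is absolutely continuous with respect to λ^m. -/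
open MeasureTheory Set Filter

section CoordinateLines

open Function Metric
open scoped Topology ENNReal NNReal

variable {ι : Type*} [DecidableEq ι]

/-- Almost every point of a measurable set `S ⊆ ℝ` satisfies a quantitative density bound. -/
lemma ae_exists_forall_volume_closedBall_inter_compl_le {S : Set ℝ} (hS : MeasurableSet S) :
    ∀ᵐ s : ℝ, s ∈ S → ∃ n : ℕ, ∀ ρ : ℝ, 0 < ρ → ρ < 1 / (n + 1) →
      volume {t | t ∈ closedBall s ρ ∧ t ∉ S} ≤ ENNReal.ofReal (ρ / 4) := by
  filter_upwards [Besicovitch.ae_tendsto_measure_inter_div_of_measurableSet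
    (volume : Measure ℝ) hS.compl] with s hs hsS
  rw [indicator_of_notMem (by simpa using hsS)] at hs
  have h := hs.eventually (Iic_mem_nhds (show (0 : ℝ≥0∞) < ENNReal.ofReal (1 / 8) by simp))
  rw [eventually_iff, Metric.mem_nhdsWithin_iff] at h
  obtain ⟨ε, hε, h⟩ := h
  obtain ⟨n, hn⟩ := exists_nat_one_div_lt hε
  refine ⟨n, fun ρ hρ hρn => ?_⟩
  have h1 := h (show ρ ∈ ball 0 ε ∩ Ioi 0 from
    ⟨by simp only [mem_ball, dist_zero_right, Real.norm_eq_abs, abs_of_pos hρ]; linarith, hρ⟩)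
  simp only [mem_ofPred_eq, Real.volume_closedBall] at h1
  rw [ENNReal.div_le_iff (by simp [hρ]) ENNReal.ofReal_ne_top,
    ← ENNReal.ofReal_mul (by norm_num)] at h1
  calc _ = volume (Sᶜ ∩ closedBall s ρ) := by congr 1; ext t; simp [and_comm]
    _ ≤ _ := h1
    _ = _ := by congr 1; ring

lemma measurableSet_closedBall_update_notMem {S : Set (ι → ℝ)} (hS : MeasurableSet S) (i : ι)
    (ρ : ℝ) : MeasurableSet
      {p : (ι → ℝ) × ℝ | p.2 ∈ closedBall (p.1 i) ρ ∧ update p.1 i p.2 ∉ S} := by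
  have h1 : Measurable fun p : (ι → ℝ) × ℝ => update p.1 i p.2 := measurable_update'
  have h2 : Measurable fun p : (ι → ℝ) × ℝ => dist p.2 (p.1 i) := by fun_prop
  exact (h2 measurableSet_Iic).inter (h1 hS.compl)

lemma add_smul_single_eq_update (x : ι → ℝ) (i : ι) (s : ℝ) :
    x + s • (Pi.single i 1 : ι → ℝ) = update x i (x i + s) := by
  ext j
  by_cases h : j = i
  · subst h; simp
  · simp [h]

variable [Fintype ι]

/-- To check that a measurable property holds almost everywhere in `ι → ℝ`, it suffices to check it
almost everywhere on every line in a fixed coordinate direction. -/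
lemma ae_mem_of_forall_ae_update_mem {S : Set (ι → ℝ)} (hS : MeasurableSet S) (i : ι)
    (h : ∀ x : ι → ℝ, ∀ᵐ t : ℝ, update x i t ∈ S) : ∀ᵐ x : ι → ℝ, x ∈ S := by
  refine ae_mem_of_ae_add_linearMap_mem
    (LinearMap.toSpanSingleton ℝ (ι → ℝ) (Pi.single i 1)) volume volume hS fun x => ?_
  simp only [LinearMap.toSpanSingleton_apply, add_smul_single_eq_update]
  exact (measurePreserving_add_left volume (x i)).quasiMeasurePreserving.ae (h x)

/-- A measurable set of positive measure has a measurable subset of positive measure at every point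
of which the set is uniformly dense along the `i`-th coordinate line. -/
lemma exists_subset_uniform_density {S : Set (ι → ℝ)} (hS : MeasurableSet S)
    (h0 : volume S ≠ 0) (i : ι) :
    ∃ T ⊆ S, MeasurableSet T ∧ volume T ≠ 0 ∧ ∃ δ > (0 : ℝ), ∀ x ∈ T, ∀ ρ : ℝ, 0 < ρ → ρ < δ →
      volume {t | t ∈ closedBall (x i) ρ ∧ update x i t ∉ S} ≤ ENNReal.ofReal (ρ / 4) := by
  let T : ℕ → Set (ι → ℝ) := fun n => S ∩ {x | ∀ q : ℚ, 0 < (q : ℝ) → (q : ℝ) < 1 / (n + 1) →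
      volume {t | t ∈ closedBall (x i) q ∧ update x i t ∉ S} ≤ ENNReal.ofReal (q / 4)}
  have hT : ∀ n, MeasurableSet (T n) := fun n => by
    refine hS.inter ?_
    simp only [ofPred_forall]
    refine .iInter fun q => .iInter fun _ => .iInter fun _ => ?_
    exact measurable_measure_prodMk_left
      (measurableSet_closedBall_update_notMem hS i q) measurableSet_Iic
  have hcover : ∀ᵐ x : ι → ℝ, x ∈ Sᶜ ∪ ⋃ n, T n := by
    refine ae_mem_of_forall_ae_update_mem (hS.compl.union (.iUnion hT)) i fun x => ?_
    filter_upwards [ae_exists_forall_volume_closedBall_inter_compl_le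
      ((measurable_update x (a := i)) hS)] with t ht
    by_cases htS : update x i t ∈ S
    · obtain ⟨n, hn⟩ := ht htS
      refine Or.inr (mem_iUnion.2 ⟨n, htS, fun q hq hqn => ?_⟩)
      simpa using hn q hq hqn
    · exact Or.inl htS
  have hpos : volume (⋃ n, T n) ≠ 0 := fun h => h0 <| by
    rw [measure_eq_zero_iff_ae_notMem] at h ⊢
    filter_upwards [h, hcover] with x hx hx'
    exact hx'.resolve_right hx
  obtain ⟨n, hn⟩ := exists_measure_pos_of_not_measure_iUnion_null hpos
  refine ⟨T n, inter_subset_left, hT n, hn.ne', 1 / (n + 1), by positivity, ?_⟩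
  intro x hx ρ hρ hρn
  have key : ∀ r : ℝ, ρ < r → volume {t | t ∈ closedBall (x i) ρ ∧ update x i t ∉ S}
      ≤ ENNReal.ofReal (r / 4) := fun r hr => by
    obtain ⟨q, hq1, hq2⟩ := exists_rat_btwn (lt_min hr hρn)
    rw [lt_min_iff] at hq2
    calc _ ≤ volume {t | t ∈ closedBall (x i) q ∧ update x i t ∉ S} :=
          measure_mono fun t ht => ⟨closedBall_subset_closedBall hq1.le ht.1, ht.2⟩
      _ ≤ _ := hx.2 q (hρ.trans hq1) hq2.2
      _ ≤ _ := ENNReal.ofReal_le_ofReal (by linarith)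
  have hlim : Tendsto (fun r : ℝ => ENNReal.ofReal (r / 4)) (𝓝[>] ρ)
      (𝓝 (ENNReal.ofReal (ρ / 4))) :=
    ((ENNReal.continuous_ofReal.comp (continuous_id.div_const 4)).tendsto ρ).mono_left
      nhdsWithin_le_nhds
  exact ge_of_tendsto hlim (eventually_mem_nhdsWithin.mono key)

lemma dist_update_update_le {x y : ι → ℝ} {ρ : ℝ} (hρ : 0 ≤ ρ) (h : dist x y ≤ ρ) (i : ι) (t : ℝ) :
    dist (update x i t) (update y i t) ≤ ρ := by
  refine (dist_pi_le_iff hρ).2 fun j => ?_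
  by_cases hj : j = i
  · subst hj; simpa using hρ
  · simpa [hj] using (dist_le_pi_dist x y j).trans h

/-- If a function has small difference quotients along almost all of the coordinate segments
through the points of `S`, then it is Lipschitz at small scales along pairs of points differing only
in the coordinates of `s`, on a subset of positive measure. -/
lemma exists_subset_dist_le_of_forall_ae_update {V : Type*} [PseudoMetricSpace V]
    {H : (ι → ℝ) → V} {ε r : ℝ} (hε : 0 ≤ ε) (hr : 0 < r) (s : Finset ι) {S : Set (ι → ℝ)}
    (hS : MeasurableSet S) (h0 : volume S ≠ 0)
    (hH : ∀ x ∈ S, ∀ i, ∀ᵐ t : ℝ, dist t (x i) < r →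
      dist (H (update x i t)) (H x) ≤ ε * dist t (x i)) :
    ∃ T ⊆ S, MeasurableSet T ∧ volume T ≠ 0 ∧ ∃ δ > (0 : ℝ), ∀ x ∈ T, ∀ y ∈ T, ∀ ρ : ℝ, 0 < ρ →
      ρ < δ → dist x y ≤ ρ → (∀ j ∉ s, x j = y j) → dist (H x) (H y) ≤ 2 * s.card * ε * ρ := by
  induction s using Finset.induction_on with
  | empty =>
    refine ⟨S, Subset.rfl, hS, h0, 1, one_pos, fun x _ y _ ρ _ _ _ hxy => ?_⟩
    have : x = y := funext fun j => hxy j (by simp)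
    simp [this]
  | insert i s hi ih =>
    obtain ⟨T', hT'S, hT', hT'0, δ', hδ', hlip⟩ := ih
    obtain ⟨T, hTT', hT, hT0, δ, hδ, hdens⟩ := exists_subset_uniform_density hT' hT'0 i
    refine ⟨T, hTT'.trans hT'S, hT, hT0, min r (min δ' δ), by positivity, ?_⟩
    intro x hx y hy ρ hρ hρlt hxy hagree
    simp only [lt_min_iff] at hρlt
    obtain ⟨hρr, hρδ', hρδ⟩ := hρlt
    have hxyi : dist (x i) (y i) ≤ ρ := (dist_le_pi_dist x y i).trans hxy
    obtain ⟨t, htx, hty, hxt, hyt, hHx, hHy⟩ : ∃ t, t ∈ closedBall (x i) ρ ∧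
        t ∈ closedBall (y i) ρ ∧ update x i t ∈ T' ∧ update y i t ∈ T' ∧
        (dist t (x i) < r → dist (H (update x i t)) (H x) ≤ ε * dist t (x i)) ∧
        (dist t (y i) < r → dist (H (update y i t)) (H y) ≤ ε * dist t (y i)) := by
      by_contra! hcon
      have hnx := ae_iff.1 (hH x (hT'S (hTT' hx)) i)
      have hny := ae_iff.1 (hH y (hT'S (hTT' hy)) i)
      have hsub : closedBall ((x i + y i) / 2) (ρ / 2) ⊆
          ({t | t ∈ closedBall (x i) ρ ∧ update x i t ∉ T'} ∪
            {t | t ∈ closedBall (y i) ρ ∧ update y i t ∉ T'}) ∪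
          ({t | ¬ (dist t (x i) < r → dist (H (update x i t)) (H x) ≤ ε * dist t (x i))} ∪
            {t | ¬ (dist t (y i) < r → dist (H (update y i t)) (H y) ≤ ε * dist t (y i))}) := by
        intro t ht
        have h1 : t ∈ closedBall (x i) ρ ∧ t ∈ closedBall (y i) ρ := by
          simp only [mem_closedBall, Real.dist_eq, abs_le] at ht hxyi ⊢
          constructor <;> constructor <;> linarith
        have h2 := hcon t h1.1 h1.2
        simp only [mem_union, mem_ofPred_eq]
        by_cases hx' : update x i t ∈ T'
        · by_cases hy' : update y i t ∈ T'
          · by_cases hx'' : dist t (x i) < r → dist (H (update x i t)) (H x) ≤ ε * dist t (x i)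
            · have h3 := h2 hx' hy' hx''
              exact Or.inr (Or.inr fun h => h3.2.not_ge (h h3.1))
            · exact Or.inr (Or.inl hx'')
          · exact Or.inl (Or.inr ⟨h1.2, hy'⟩)
        · exact Or.inl (Or.inl ⟨h1.1, hx'⟩)
      have hle := (measure_mono hsub).trans (measure_union_le (μ := (volume : Measure ℝ)) _ _)
      rw [measure_union_null hnx hny, add_zero, Real.volume_closedBall] at hle
      have hle' := (hle.trans (measure_union_le _ _)).trans
        (add_le_add (hdens x hx ρ hρ hρδ) (hdens y hy ρ hρ hρδ))
      rw [← ENNReal.ofReal_add (by positivity) (by positivity),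
        ENNReal.ofReal_le_ofReal_iff (by positivity)] at hle'
      linarith
    have h1 := (hHx (lt_of_le_of_lt htx hρr)).trans (mul_le_mul_of_nonneg_left htx hε)
    have h2 := (hHy (lt_of_le_of_lt hty hρr)).trans (mul_le_mul_of_nonneg_left hty hε)
    have h3 := hlip _ hxt _ hyt ρ hρ hρδ' (dist_update_update_le hρ.le hxy i t) fun j hj => by
      by_cases hji : j = i
      · subst hji; simp
      · simpa [hji] using hagree j (by simp [hji, hj])
    have h4 := dist_triangle4 (H x) (H (update x i t)) (H (update y i t)) (H y)
    rw [dist_comm (H x) (H (update x i t))] at h4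
    rw [Finset.card_insert_of_notMem hi]
    push_cast
    linarith

/-- A measurable set that `F` maps into a null set is null, if `F` has almost everywhere small
deviations from a fixed linear map with nonzero determinant along the coordinate lines through the
points of the set. -/
lemma exists_pos_volume_eq_zero_of_update_sub_le {A : (ι → ℝ) →L[ℝ] (ι → ℝ)} (hA : A.det ≠ 0) :
    ∃ ε > (0 : ℝ), ∀ (F : (ι → ℝ) → (ι → ℝ)) (r : ℝ) (S : Set (ι → ℝ)), 0 < r → MeasurableSet S →
      volume (F '' S) = 0 →
      (∀ x ∈ S, ∀ i, ∀ᵐ t : ℝ, dist t (x i) < r →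
        dist (F (update x i t) - A (update x i t)) (F x - A x) ≤ ε * dist t (x i)) →
      volume S = 0 := by
  obtain ⟨c, hc0, hc⟩ := ENNReal.lt_iff_exists_nnreal_btwn.1
    (show (0 : ℝ≥0∞) < ENNReal.ofReal |A.det| by simpa using hA)
  obtain ⟨κ, hκ, hκ0⟩ := ((mul_le_addHaar_image_of_lt_det volume A hc).and
    (eventually_mem_nhdsWithin (a := (0 : ℝ≥0)) (s := Ioi 0))).exists
  have hκ0' : (0 : ℝ) < κ := hκ0
  set ε : ℝ := κ / (2 * Fintype.card ι + 1) with hεdef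
  have hε : 0 < ε := by positivity
  refine ⟨ε, hε, fun F r S hr hS hFS h => ?_⟩
  by_contra h0
  obtain ⟨T, hTS, -, hT0, δ, hδ, hlip⟩ := exists_subset_dist_le_of_forall_ae_update
    (H := fun x => F x - A x) hε.le hr Finset.univ hS h0 h
  refine hT0 (measure_null_of_locally_null T fun x _ => ?_)
  refine ⟨T ∩ ball x (δ / 2), inter_mem_nhdsWithin _ (ball_mem_nhds _ (by positivity)), ?_⟩
  have happrox : ApproximatesLinearOn F A (T ∩ ball x (δ / 2)) κ := by
    intro y hy z hz
    rcases eq_or_ne y z with rfl | hyz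
    · simp
    have hd : dist y z < δ := by
      have := dist_triangle_right y z x
      have h1 := mem_ball.1 hy.2
      have h2 := mem_ball.1 hz.2
      linarith
    have h1 := hlip y hy.1 z hz.1 (dist y z) (dist_pos.2 hyz) hd le_rfl (by simp)
    rw [Finset.card_univ] at h1
    calc ‖F y - F z - A (y - z)‖ = dist (F y - A y) (F z - A z) := by
          rw [dist_eq_norm, map_sub]; congr 1; abel
      _ ≤ _ := h1
      _ ≤ κ * dist y z := by
          refine mul_le_mul_of_nonneg_right ?_ dist_nonneg
          have : (2 * Fintype.card ι + 1) * ε = κ := by rw [hεdef]; field_simp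
          linarith
      _ = κ * ‖y - z‖ := by rw [dist_eq_norm]
  have h1 := hκ _ F happrox
  rw [measure_mono_null (image_mono (inter_subset_left.trans hTS)) hFS] at h1
  simpa [hc0.ne'] using h1

/-- If the coordinate partial derivatives of a measurable map `F` at each point `x` of `N` are those
of an invertible linear map `L x`, then the preimage in `N` of a null set is null. -/
lemma volume_inter_preimage_eq_zero_of_partial_deriv {F : (ι → ℝ) → (ι → ℝ)} (hF : Measurable F)
    {N : Set (ι → ℝ)} {L : (ι → ℝ) → (ι → ℝ) →L[ℝ] (ι → ℝ)} (hL : ∀ x ∈ N, (L x).det ≠ 0)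
    (hN : ∀ x ∈ N, ∀ i, HasDerivAt (fun t : ℝ => F (x + t • (Pi.single i 1 : ι → ℝ)))
      (L x (Pi.single i 1)) 0) {Z : Set (ι → ℝ)} (hZ : MeasurableSet Z) (hZ0 : volume Z = 0) :
    volume (N ∩ F ⁻¹' Z) = 0 := by
  choose! ε hε hnull using fun (A : (ι → ℝ) →L[ℝ] (ι → ℝ)) (hA : A.det ≠ 0) =>
    exists_pos_volume_eq_zero_of_update_sub_le hA
  obtain ⟨C, hCsub, hC, hcover⟩ := TopologicalSpace.countable_cover_nhdsWithin
    (s := {A : (ι → ℝ) →L[ℝ] (ι → ℝ) | A.det ≠ 0}) (f := fun A => ball A (ε A / 2))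
    fun A hA => mem_nhdsWithin_of_mem_nhds (ball_mem_nhds A (half_pos (hε A hA)))
  let W : ((ι → ℝ) →L[ℝ] (ι → ℝ)) → ℕ → Set (ι → ℝ) := fun A n => F ⁻¹' Z ∩
    {x | ∀ i, ∀ᵐ t : ℝ, dist t (x i) < 1 / ((n : ℝ) + 1) →
      dist (F (update x i t) - A (update x i t)) (F x - A x) ≤ ε A * dist t (x i)}
  have hWmeas : ∀ A n, MeasurableSet (W A n) := fun A n => by
    refine (hF hZ).inter ?_
    simp only [ofPred_forall]
    refine .iInter fun i => ?_
    have hu : Measurable fun p : (ι → ℝ) × ℝ => update p.1 i p.2 := measurable_update'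
    have h1 : Measurable fun p : (ι → ℝ) × ℝ =>
        dist (F (update p.1 i p.2) - A (update p.1 i p.2)) (F p.1 - A p.1) :=
      ((hF.comp hu).sub (A.continuous.measurable.comp hu)).dist
        ((hF.comp measurable_fst).sub (A.continuous.measurable.comp measurable_fst))
    have h2 : Measurable fun p : (ι → ℝ) × ℝ => dist p.2 (p.1 i) := by fun_prop
    have h3 : MeasurableSet {p : (ι → ℝ) × ℝ | ¬ (dist p.2 (p.1 i) < 1 / ((n : ℝ) + 1) →
        dist (F (update p.1 i p.2) - A (update p.1 i p.2)) (F p.1 - A p.1) ≤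
          ε A * dist p.2 (p.1 i))} :=
      ((measurableSet_lt h2 measurable_const).imp (measurableSet_le h1 (h2.const_mul _))).compl
    exact measurable_measure_prodMk_left h3 (measurableSet_singleton 0)
  have hW0 : volume (⋃ A ∈ C, ⋃ n, W A n) = 0 := by
    refine (measure_biUnion_null_iff hC).2 fun A hAC => measure_iUnion_null fun n => ?_
    refine hnull A (hCsub hAC) F (1 / (n + 1)) _ (by positivity) (hWmeas A n) ?_ fun x hx => hx.2
    exact measure_mono_null (image_subset_iff.2 inter_subset_left) hZ0
  refine measure_mono_null ?_ hW0
  rintro x ⟨hxN, hxZ⟩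
  obtain ⟨A, hAC, hxA⟩ := mem_iUnion₂.1 (hcover (hL x hxN))
  have hεA := hε A (hCsub hAC)
  have hev : ∀ i, ∀ᶠ s in 𝓝 (0 : ℝ),
      ‖F (x + s • (Pi.single i 1 : ι → ℝ)) - F x - s • L x (Pi.single i 1)‖ ≤
        ε A / 2 * ‖s‖ := fun i => by
    simpa using (hasDerivAt_iff_isLittleO_nhds_zero.1 (hN x hxN i)).def (half_pos hεA)
  obtain ⟨η, hη, hball⟩ := Metric.eventually_nhds_iff.1 (eventually_all.2 hev)
  obtain ⟨n, hn⟩ := exists_nat_one_div_lt hη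
  refine mem_iUnion₂.2 ⟨A, hAC, mem_iUnion.2 ⟨n, hxZ, fun i => .of_forall fun t ht => ?_⟩⟩
  have hs := hball (y := t - x i) (by simpa [Real.dist_eq] using ht.trans hn) i
  have hup : update x i t = x + (t - x i) • (Pi.single i 1 : ι → ℝ) := by
    rw [add_smul_single_eq_update]; simp
  have hLA : ‖(L x - A) (Pi.single i 1)‖ ≤ ε A / 2 := by
    have h1 := (L x - A).le_opNorm (Pi.single i 1)
    rw [mem_ball, dist_eq_norm] at hxA
    simp only [Pi.norm_single, norm_one, mul_one] at h1
    linarith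
  rw [hup, dist_eq_norm, Real.dist_eq, ← Real.norm_eq_abs]
  calc _ = ‖(F (x + (t - x i) • (Pi.single i 1 : ι → ℝ)) - F x
          - (t - x i) • L x (Pi.single i 1)) + (t - x i) • (L x - A) (Pi.single i 1)‖ := by
        congr 1
        simp only [map_add, map_smul, sub_apply, smul_sub]
        abel
    _ ≤ ε A / 2 * ‖t - x i‖ + ‖t - x i‖ * (ε A / 2) := by
        refine (norm_add_le _ _).trans (add_le_add hs ?_)
        rw [norm_smul]
        gcongr
    _ = _ := by ring

end CoordinateLines

open MeasureTheory Set Filter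

/-- If `F : ℝ^m → ℝ^m` is measurable and at `λ^m`-a.e. point all coordinate partial
derivatives exist (collected into the matrix `G x`, whose `i`-th column is the derivative
at `t = 0` of `t ↦ F (x + t • e i)`), and `N` is the set of points where all partial
derivatives exist and `det (G x) ≠ 0`, then the pushforward under `F` of `λ^m` restricted
to `N` is absolutely continuous with respect to `λ^m`. -/
theorem stmt6 (m : ℕ) (F : (Fin m → ℝ) → (Fin m → ℝ)) (hF : Measurable F)
    (G : (Fin m → ℝ) → Matrix (Fin m) (Fin m) ℝ)
    (hdiff : ∀ᵐ x : Fin m → ℝ ∂volume, ∀ i : Fin m,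
      HasDerivAt (fun t : ℝ => F (x + t • (Pi.single i 1 : Fin m → ℝ)))
        (fun j => G x j i) 0) :
    (volume.restrict {x : Fin m → ℝ |
        (∀ i : Fin m, HasDerivAt (fun t : ℝ => F (x + t • (Pi.single i 1 : Fin m → ℝ)))
          (fun j => G x j i) 0) ∧ (G x).det ≠ 0}).map F ≪ volume := by
  refine Measure.AbsolutelyContinuous.mk fun Z hZ hZ0 => ?_
  rw [Measure.map_apply hF hZ, Measure.restrict_apply (hF hZ), inter_comm]
  refine volume_inter_preimage_eq_zero_of_partial_deriv hF
    (L := fun x => LinearMap.toContinuousLinearMap (Matrix.toLin' (G x))) ?_ ?_ hZ hZ0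
  · intro x hx
    simpa [ContinuousLinearMap.det] using hx.2
  · intro x hx i
    have h : LinearMap.toContinuousLinearMap (Matrix.toLin' (G x)) (Pi.single i 1) =
        fun j => G x j i := by
      simp only [LinearMap.coe_toContinuousLinearMap', Matrix.toLin'_apply,
        Matrix.mulVec_single_one]
      rfl
    rw [h]
    exact hx.1 i
end

section
/- Let (c,d) ⊂ ℝ be a bounded open interval and g : (c,d) → ℝ be monotone (non-decreasing or non-increasing). Then for every γ > 0 there exist a function G ∈ C¹(ℝ) and a compact set K ⊂ (c,d) with λ¹((c,d) \ K) ≤ γ such that g is continuous at every point of K and g(x) = G(x) for every x ∈ K. -/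
open MeasureTheory Set Filter

lemma abs_mul_cubicStep_le {u v q ε δ M : ℝ} (hu : 0 ≤ u) (hv : 0 ≤ v) (huv : 0 < u + v)
    (hε : 0 ≤ ε) (hδ : 0 ≤ δ) (hM : |q| ≤ M) (hq : u + v < δ → |q| ≤ ε * (u + v))
    (hMu : M * u ≤ ε * δ ^ 2) :
    |q * (u ^ 2 * (u + 3 * v) / (u + v) ^ 3)| ≤ 3 * ε * u ∧
      |q * (6 * u * v / (u + v) ^ 3)| ≤ 6 * ε := by
  have key : |q| * u ≤ ε * (u + v) ^ 2 := by
    rcases lt_or_ge (u + v) δ with h | h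
    · calc |q| * u ≤ ε * (u + v) * (u + v) :=
            mul_le_mul (hq h) (by linarith) hu (by positivity)
        _ = _ := by ring
    · calc |q| * u ≤ M * u := by gcongr
        _ ≤ ε * δ ^ 2 := hMu
        _ ≤ _ := by gcongr
  have hl : 0 < (u + v) ^ 3 := by positivity
  constructor
  · rw [abs_mul, abs_of_nonneg (show 0 ≤ u ^ 2 * (u + 3 * v) / (u + v) ^ 3 by positivity),
      ← mul_div_assoc, div_le_iff₀ hl]
    calc |q| * (u ^ 2 * (u + 3 * v)) = (|q| * u) * (u * (u + 3 * v)) := by ring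
      _ ≤ (ε * (u + v) ^ 2) * (u * (3 * (u + v))) := by gcongr; linarith
      _ = _ := by ring
  · rw [abs_mul, abs_of_nonneg (show 0 ≤ 6 * u * v / (u + v) ^ 3 by positivity),
      ← mul_div_assoc, div_le_iff₀ hl]
    calc |q| * (6 * u * v) = (|q| * u) * (6 * v) := by ring
      _ ≤ (ε * (u + v) ^ 2) * (6 * (u + v)) := by gcongr; linarith
      _ = _ := by ring

lemma IsClosed.exists_gap_endpoints {S : Set ℝ} (hS : IsClosed S) {x : ℝ}
    (hb : ∃ a ∈ S, a ≤ x) (ht : ∃ b ∈ S, x ≤ b) :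
    ∃ a ∈ S, ∃ b ∈ S, a ≤ x ∧ x ≤ b ∧ (∀ s ∈ S, s ≤ a ∨ b ≤ s) ∧
      (x ∈ S → a = x ∧ b = x) := by
  obtain ⟨a₀, ha₀, hax⟩ := hb
  obtain ⟨b₀, hb₀, hbx⟩ := ht
  have ha := (hS.inter isClosed_Iic).isGreatest_csSup (s := S ∩ Iic x) ⟨a₀, ha₀, hax⟩
    ⟨x, fun _ h => h.2⟩
  have hb := (hS.inter isClosed_Ici).isLeast_csInf (s := S ∩ Ici x) ⟨b₀, hb₀, hbx⟩
    ⟨x, fun _ h => h.2⟩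
  refine ⟨_, ha.1.1, _, hb.1.1, ha.1.2, hb.1.2, fun s hs => ?_, fun hx =>
    ⟨le_antisymm ha.1.2 (ha.2 ⟨hx, le_refl x⟩), le_antisymm (hb.2 ⟨hx, le_refl x⟩) hb.1.2⟩⟩
  rcases le_total s x with h | h
  · exact Or.inl (ha.2 ⟨hs, h⟩)
  · exact Or.inr (hb.2 ⟨hs, h⟩)

/-- A bounded function on a closed set, unbounded in both directions, whose increments are
uniformly `o(|y - x|)`, extends to a `C¹` function: interpolate across the gaps by cubics with
vanishing derivative at the endpoints. -/
lemma exists_contDiff_one_eqOn_of_uniform_littleO {S : Set ℝ} (hS : IsClosed S)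
    (hb : ∀ x, ∃ a ∈ S, a ≤ x) (ht : ∀ x, ∃ b ∈ S, x ≤ b) {r : ℝ → ℝ} {M : ℝ}
    (hM : ∀ x ∈ S, ∀ y ∈ S, |r y - r x| ≤ M)
    (hr : ∀ ε > 0, ∃ δ > 0, ∀ x ∈ S, ∀ y ∈ S, |y - x| < δ → |r y - r x| ≤ ε * |y - x|) :
    ∃ R : ℝ → ℝ, ContDiff ℝ 1 R ∧ EqOn R r S := by
  choose a haS b hbS hax hxb hgap hmem using fun x => hS.exists_gap_endpoints (hb x) (ht x)
  set R : ℝ → ℝ := fun y => r (a y) + (r (b y) - r (a y)) *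
    ((y - a y) ^ 2 * ((y - a y) + 3 * (b y - y)) / ((y - a y) + (b y - y)) ^ 3) with hR
  set h : ℝ → ℝ := fun y => (r (b y) - r (a y)) *
    (6 * (y - a y) * (b y - y) / ((y - a y) + (b y - y)) ^ 3) with hh
  have hRS : ∀ x ∈ S, R x = r x := fun x hx => by simp [hR, hmem x hx]
  have hhS : ∀ x ∈ S, h x = 0 := fun x hx => by simp [hh, hmem x hx]
  have hlt : ∀ y ∉ S, a y < y ∧ y < b y := fun y hy =>
    ⟨(hax y).lt_of_ne fun e => hy (e ▸ haS y), (hxb y).lt_of_ne fun e => hy (e ▸ hbS y)⟩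
  have hconst : ∀ y, ∀ z ∈ Ioo (a y) (b y), a z = a y ∧ b z = b y := by
    intro y z hz
    have h₁ := hgap y _ (haS z)
    have h₂ := hgap y _ (hbS z)
    have h₃ := hgap z _ (haS y)
    have h₄ := hgap z _ (hbS y)
    have := hax z
    have := hxb z
    obtain ⟨hz₁, hz₂⟩ := hz
    constructor <;> apply le_antisymm <;> grind
  have hest : ∀ ε > 0, ∃ δ > 0, ∀ x ∈ S, ∀ y, |y - x| < δ →
      |R y - R x| ≤ ε * |y - x| ∧ |h y| ≤ ε := by
    intro ε hε
    obtain ⟨δ, hδ, hrδ⟩ := hr (ε / 6) (by positivity)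
    have hM0 : 0 ≤ M := (abs_nonneg _).trans (hM _ (haS 0) _ (haS 0))
    set η := ε / 6 * δ ^ 2 / (M + 1) with hη
    have hη0 : 0 < η := by positivity
    have hMη : ∀ u, 0 ≤ u → u < η → M * u ≤ ε / 6 * δ ^ 2 := fun u hu huη => by
      have : u * (M + 1) < ε / 6 * δ ^ 2 := by rwa [hη, lt_div_iff₀ (by positivity)] at huη
      nlinarith
    refine ⟨min δ η, lt_min hδ hη0, fun x hx y hxy => ?_⟩
    by_cases hy : y ∈ S
    · rw [hRS x hx, hRS y hy, hhS y hy, abs_zero]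
      refine ⟨(hrδ x hx y hy (hxy.trans_le (min_le_left _ _))).trans ?_, hε.le⟩
      gcongr
      linarith
    obtain ⟨hay, hyb⟩ := hlt y hy
    have hxyδ := hxy.trans_le (min_le_left _ _)
    have hxyη := hxy.trans_le (min_le_right _ _)
    have hq : (y - a y) + (b y - y) < δ →
        |r (b y) - r (a y)| ≤ ε / 6 * ((y - a y) + (b y - y)) := fun hl => by
      have hab : |b y - a y| = (y - a y) + (b y - y) := by
        rw [abs_of_pos (by linarith)]; ring
      rw [← hab]
      exact hrδ _ (haS y) _ (hbS y) (by rwa [hab])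
    rcases hgap y x hx with hxa | hbx
    · have hyx : |y - x| = y - x := abs_of_pos (by linarith)
      rw [hyx] at hxyδ hxyη ⊢
      obtain ⟨h₁, h₂⟩ := abs_mul_cubicStep_le (sub_nonneg.2 hay.le) (sub_nonneg.2 hyb.le)
        (by linarith) (by positivity) hδ.le (hM _ (haS y) _ (hbS y)) hq
        (hMη _ (by linarith) (by linarith))
      refine ⟨?_, h₂.trans (by linarith)⟩
      have h₃ := hrδ x hx _ (haS y) (by rw [abs_of_nonneg (by linarith)]; linarith)
      rw [abs_of_nonneg (sub_nonneg.2 hxa)] at h₃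
      rw [hRS x hx]
      calc |R y - r x| = |(r (a y) - r x) + (R y - r (a y))| := by ring_nf
        _ ≤ |r (a y) - r x| + |R y - r (a y)| := abs_add_le _ _
        _ ≤ ε / 6 * (a y - x) + 3 * (ε / 6) * (y - a y) := by
          refine add_le_add h₃ ?_
          simpa only [hR, add_sub_cancel_left] using h₁
        _ ≤ ε * (y - x) := by nlinarith
    · have hyx : |y - x| = x - y := by rw [abs_sub_comm]; exact abs_of_pos (by linarith)
      rw [hyx] at hxyδ hxyη ⊢
      have hsum : (b y - y) + (y - a y) = (y - a y) + (b y - y) := add_comm _ _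
      obtain ⟨h₁, h₂⟩ := abs_mul_cubicStep_le (sub_nonneg.2 hyb.le) (sub_nonneg.2 hay.le)
        (by linarith) (by positivity) hδ.le (hM _ (haS y) _ (hbS y)) (by rwa [hsum])
        (hMη _ (by linarith) (by linarith))
      rw [hsum] at h₁ h₂
      have hl : (y - a y) + (b y - y) ≠ 0 := by linarith
      refine ⟨?_, le_trans (le_of_eq ?_) (h₂.trans (by linarith))⟩
      · have h₃ := hrδ x hx _ (hbS y) (by rw [abs_sub_comm, abs_of_nonneg (by linarith)]; linarith)
        rw [abs_sub_comm (b y), abs_of_nonneg (sub_nonneg.2 hbx)] at h₃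
        rw [hRS x hx]
        have hRb : R y - r (b y) = -((r (b y) - r (a y)) *
            ((b y - y) ^ 2 * ((b y - y) + 3 * (y - a y)) / ((y - a y) + (b y - y)) ^ 3)) := by
          simp only [hR]
          generalize b y - y = v at *
          generalize y - a y = u at *
          field_simp
          ring
        calc |R y - r x| = |(r (b y) - r x) + (R y - r (b y))| := by ring_nf
          _ ≤ |r (b y) - r x| + |R y - r (b y)| := abs_add_le _ _
          _ ≤ ε / 6 * (x - b y) + 3 * (ε / 6) * (b y - y) := by
            refine add_le_add h₃ ?_
            rwa [hRb, abs_neg]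
          _ ≤ ε * (x - y) := by nlinarith
      · simp only [hh]
        ring_nf
  have hderiv : ∀ y, HasDerivAt R (h y) y := by
    intro y
    by_cases hy : y ∈ S
    · rw [hhS y hy, hasDerivAt_iff_isLittleO, Asymptotics.isLittleO_iff]
      intro ε hε
      obtain ⟨δ, hδ, H⟩ := hest ε hε
      filter_upwards [Metric.ball_mem_nhds y hδ] with z hz
      simpa using (H y hy z hz).1
    · have hab := hlt y hy
      have hl : (y - a y) + (b y - y) ≠ 0 := by linarith
      have hl' : b y - a y ≠ 0 := by linarith
      have h₁ : HasDerivAt (fun z => r (a y) + (r (b y) - r (a y)) *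
          ((z - a y) ^ 2 * ((z - a y) + 3 * (b y - z)) / (b y - a y) ^ 3)) (h y) y := by
        have hu := (hasDerivAt_id y).sub_const (a y)
        have hv := (hasDerivAt_id y).const_sub (b y)
        refine HasDerivAt.congr_deriv (((((hu.pow 2).mul (hu.add (hv.const_mul 3))).div_const
          ((b y - a y) ^ 3)).const_mul (r (b y) - r (a y))).const_add (r (a y))) ?_
        simp only [hh, id, Pi.add_apply, Pi.pow_apply]
        rw [show (y - a y) + (b y - y) = b y - a y by ring]
        field_simp
        push_cast
        ring
      refine h₁.congr_of_eventuallyEq ?_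
      filter_upwards [Ioo_mem_nhds hab.1 hab.2] with z hz
      simp only [hR, hconst y z hz]
      rw [show (z - a y) + (b y - z) = b y - a y by ring]
  refine ⟨R, contDiff_one_iff_deriv.2 ⟨fun y => (hderiv y).differentiableAt, ?_⟩, hRS⟩
  rw [show deriv R = h from funext fun y => (hderiv y).deriv, continuous_iff_continuousAt]
  intro y
  by_cases hy : y ∈ S
  · rw [Metric.continuousAt_iff]
    intro ε hε
    obtain ⟨δ, hδ, H⟩ := hest (ε / 2) (by positivity)
    refine ⟨δ, hδ, fun {z} hz => ?_⟩
    rw [hhS y hy, dist_zero_right]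
    exact (H y hy z hz).2.trans_lt (by linarith)
  · have hab := hlt y hy
    have h₁ : Continuous fun z => (r (b y) - r (a y)) *
        (6 * (z - a y) * (b y - z) / (b y - a y) ^ 3) := by fun_prop
    refine h₁.continuousAt.congr ?_
    filter_upwards [Ioo_mem_nhds hab.1 hab.2] with z hz
    simp only [hh, hconst y z hz]
    rw [show (z - a y) + (b y - z) = b y - a y by ring]

lemma IsCompact.exists_contDiff_one_eqOn_of_uniform_littleO {K : Set ℝ} (hK : IsCompact K)
    {r : ℝ → ℝ}
    (hr : ∀ ε > 0, ∃ δ > 0, ∀ x ∈ K, ∀ y ∈ K, |y - x| < δ → |r y - r x| ≤ ε * |y - x|) :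
    ∃ R : ℝ → ℝ, ContDiff ℝ 1 R ∧ EqOn R r K := by
  rcases K.eq_empty_or_nonempty with rfl | hne
  · exact ⟨0, contDiff_const, eqOn_empty _ _⟩
  have hcont : ContinuousOn r K := by
    rw [Metric.continuousOn_iff]
    intro x hx ε hε
    obtain ⟨δ, hδ, H⟩ := hr 1 one_pos
    refine ⟨min δ ε, lt_min hδ hε, fun y hy hyx => ?_⟩
    have := H x hx y hy (hyx.trans_le (min_le_left _ _))
    rw [one_mul] at this
    exact this.trans_lt (hyx.trans_le (min_le_right _ _))
  obtain ⟨M, hM⟩ := Metric.isBounded_iff.1 (hK.image_of_continuousOn hcont).isBounded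
  obtain ⟨m, hm⟩ := hK.exists_isLeast hne
  obtain ⟨n, hn⟩ := hK.exists_isGreatest hne
  have hmn : m ≤ n := hm.2 hn.1
  set p : ℝ → ℝ := fun x => max m (min x n) with hp
  have hpcont : Continuous p := by fun_prop
  have hpK : ∀ x ∈ K, p x = x := fun x hx => by
    simp [hp, hm.2 hx, hn.2 hx]
  have hpl : ∀ x y, |p y - p x| ≤ |y - x| := fun x y => by
    calc |p y - p x| ≤ |min y n - min x n| := by
          simpa using abs_max_sub_max_le_max m (min y n) m (min x n)
      _ ≤ |y - x| := by simpa using abs_min_sub_min_le_max y n x n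
  obtain ⟨R, hR, hRr⟩ := _root_.exists_contDiff_one_eqOn_of_uniform_littleO (S := p ⁻¹' K)
    (r := r ∘ p) (M := M) (hK.isClosed.preimage hpcont)
    (fun x => ⟨min x m, by simpa [hp, hmn] using hm.1, min_le_left _ _⟩)
    (fun x => ⟨max x n, by simpa [hp, hmn] using hn.1, le_max_left _ _⟩)
    (fun x hx y hy => hM (mem_image_of_mem r hy) (mem_image_of_mem r hx))
    (fun ε hε => by
      obtain ⟨δ, hδ, H⟩ := hr ε hε
      refine ⟨δ, hδ, fun x hx y hy hxy => ?_⟩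
      exact (H _ hx _ hy ((hpl x y).trans_lt hxy)).trans (mul_le_mul_of_nonneg_left (hpl x y) hε.le))
  refine ⟨R, hR, fun x hx => ?_⟩
  rw [hRr (show p x ∈ K by rwa [hpK x hx]), Function.comp_apply, hpK x hx]

/-- The one-dimensional `C¹` Whitney extension theorem on compact sets. -/
theorem IsCompact.exists_contDiff_one_eqOn {K : Set ℝ} (hK : IsCompact K) {f f' : ℝ → ℝ}
    (hf : ∀ ε > 0, ∃ δ > 0, ∀ x ∈ K, ∀ y ∈ K, |y - x| < δ →
      |f y - f x - f' x * (y - x)| ≤ ε * |y - x|) :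
    ∃ G : ℝ → ℝ, ContDiff ℝ 1 G ∧ EqOn G f K := by
  have hf' : ContinuousOn f' K := by
    rw [Metric.continuousOn_iff]
    intro x hx ε hε
    obtain ⟨δ, hδ, H⟩ := hf (ε / 3) (by positivity)
    refine ⟨δ, hδ, fun y hy hyx => ?_⟩
    rcases eq_or_ne y x with rfl | hne
    · simpa using hε
    have hpos : 0 < |y - x| := abs_pos.2 (sub_ne_zero.2 hne)
    rw [Real.dist_eq] at hyx ⊢
    have h₁ := H x hx y hy hyx
    have h₂ := H y hy x hx (by rwa [abs_sub_comm])
    rw [abs_sub_comm x y] at h₂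
    have h₃ : |f' y - f' x| * |y - x| ≤ (ε / 3 + ε / 3) * |y - x| := by
      rw [← abs_mul, add_mul]
      refine le_trans (le_of_eq ?_) ((abs_add_le _ _).trans (add_le_add h₁ h₂))
      congr 1
      ring
    linarith [le_of_mul_le_mul_right h₃ hpos]
  obtain ⟨φ, hφ⟩ := ContinuousMap.exists_restrict_eq hK.isClosed ⟨_, hf'.domRestrict⟩
  have hφK : ∀ x ∈ K, φ x = f' x := fun x hx => DFunLike.congr_fun hφ ⟨x, hx⟩
  set F : ℝ → ℝ := fun x => ∫ t in (0 : ℝ)..x, φ t with hF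
  have hFd : ∀ x, HasDerivAt F (φ x) x := fun x =>
    φ.continuous.integral_hasStrictDerivAt 0 x |>.hasDerivAt
  have hFC : ContDiff ℝ 1 F := contDiff_one_iff_deriv.2
    ⟨fun x => (hFd x).differentiableAt, by
      rw [show deriv F = φ from funext fun y => (hFd y).deriv]; exact φ.continuous⟩
  obtain ⟨R, hR, hRK⟩ := hK.exists_contDiff_one_eqOn_of_uniform_littleO
    (r := fun x => f x - F x) fun ε hε => by
    obtain ⟨δ₁, hδ₁, H₁⟩ := hf (ε / 2) (by positivity)
    obtain ⟨a, b, hab⟩ : ∃ a b, K ⊆ Icc a b :=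
      ⟨_, _, fun x hx => ⟨(hK.bddBelow.some_mem hx), (hK.bddAbove.some_mem hx)⟩⟩
    obtain ⟨δ₂, hδ₂, H₂⟩ := Metric.uniformContinuousOn_iff.1
      (isCompact_Icc.uniformContinuousOn_of_continuous (s := Icc a b) φ.continuous.continuousOn)
      (ε / 2) (by positivity)
    refine ⟨min δ₁ δ₂, lt_min hδ₁ hδ₂, fun x hx y hy hxy => ?_⟩
    have h₁ := H₁ x hx y hy (hxy.trans_le (min_le_left _ _))
    have h₂ := Convex.norm_image_sub_le_of_norm_hasDerivWithin_le (s := uIcc x y)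
      (f := fun z => F z - φ x * z) (f' := fun z => φ z - φ x) (C := ε / 2) (x := x) (y := y)
      (fun z _ =>
        (((hFd z).sub ((hasDerivAt_id z).const_mul (φ x))).congr_deriv
          (by rw [mul_one])).hasDerivWithinAt)
      (fun z hz => (H₂ z (uIcc_subset_Icc (hab hx) (hab hy) hz) x (hab hx) <| by
        rw [Real.dist_eq]
        exact (abs_sub_left_of_mem_uIcc hz).trans_lt (hxy.trans_le (min_le_right _ _))).le)
      (convex_uIcc x y) left_mem_uIcc right_mem_uIcc
    rw [Real.norm_eq_abs, Real.norm_eq_abs, hφK x hx] at h₂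
    calc |f y - F y - (f x - F x)|
        = |(f y - f x - f' x * (y - x)) - ((F y - f' x * y) - (F x - f' x * x))| := by ring_nf
      _ ≤ ε / 2 * |y - x| + ε / 2 * |y - x| := (abs_sub _ _).trans (add_le_add h₁ h₂)
      _ = ε * |y - x| := by ring
  exact ⟨fun x => R x + F x, hR.add hFC, fun x hx => by simp [hRK hx]⟩

lemma ContinuousAt.le_of_forall_rat_gt {ψ : ℝ → ℝ} {y e C : ℝ} (hψ : ContinuousAt ψ y)
    (hye : y < e) (h : ∀ q : ℚ, y < q → (q : ℝ) < e → C ≤ ψ q) : C ≤ ψ y := by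
  by_contra! hlt
  obtain ⟨u, hu, hsub⟩ := mem_nhdsGT_iff_exists_Ioo_subset.1
    (mem_nhdsWithin_of_mem_nhds (s := {z | ψ z < C}) (hψ.eventually_lt_const hlt))
  obtain ⟨q, hyq, hqu⟩ := exists_rat_btwn (lt_min hu hye)
  exact (hsub ⟨hyq, hqu.trans_le (min_le_left _ _)⟩).not_ge
    (h q hyq (hqu.trans_le (min_le_right _ _)))

lemma ContinuousAt.le_of_forall_rat_lt {ψ : ℝ → ℝ} {y e C : ℝ} (hψ : ContinuousAt ψ y)
    (hey : e < y) (h : ∀ q : ℚ, (q : ℝ) < y → e < q → ψ q ≤ C) : ψ y ≤ C := by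
  by_contra! hlt
  obtain ⟨l, hl, hsub⟩ := mem_nhdsLT_iff_exists_Ioo_subset.1
    (mem_nhdsWithin_of_mem_nhds (s := {z | C < ψ z}) (hψ.eventually_const_lt hlt))
  obtain ⟨q, hlq, hqy⟩ := exists_rat_btwn (max_lt hl hey)
  exact (hsub ⟨(le_max_left _ _).trans_lt hlq, hqy⟩).not_ge
    (h q hqy ((le_max_right _ _).trans_lt hlq))

/-- For a monotone function, first order approximation at rational points near `x` gives first
order approximation at all points near `x`. -/
lemma MonotoneOn.abs_sub_sub_le_of_forall_rat {g : ℝ → ℝ} {c d x m ε δ : ℝ}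
    (hg : MonotoneOn g (Ioo c d))
    (h : ∀ q : ℚ, (q : ℝ) ∈ Ioo c d → |q - x| < δ → |g q - g x - m * (q - x)| ≤ ε * |q - x|)
    {y : ℝ} (hy : y ∈ Ioo c d) (hyx : |y - x| < δ) :
    |g y - g x - m * (y - x)| ≤ ε * |y - x| := by
  rw [abs_lt] at hyx
  have hup : g y ≤ g x + m * (y - x) + ε * |y - x| := by
    refine ContinuousAt.le_of_forall_rat_gt (ψ := fun z => g x + m * (z - x) + ε * |z - x|)
      (e := min d (x + δ)) (by fun_prop) (lt_min hy.2 (by linarith)) fun q hyq hqe => ?_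
    rw [lt_min_iff] at hqe
    have hq : (q : ℝ) ∈ Ioo c d := ⟨hy.1.trans hyq, hqe.1⟩
    have := (abs_le.1 (h q hq (abs_lt.2 ⟨by linarith, by linarith⟩))).2
    linarith [hg hy hq hyq.le]
  have hlo : g x + m * (y - x) - ε * |y - x| ≤ g y := by
    refine ContinuousAt.le_of_forall_rat_lt (ψ := fun z => g x + m * (z - x) - ε * |z - x|)
      (e := max c (x - δ)) (by fun_prop) (max_lt hy.1 (by linarith)) fun q hqy hqe => ?_
    rw [max_lt_iff] at hqe
    have hq : (q : ℝ) ∈ Ioo c d := ⟨hqe.1, hqy.trans hy.2⟩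
    have := (abs_le.1 (h q hq (abs_lt.2 ⟨by linarith, by linarith⟩))).1
    linarith [hg hq hy hqy.le]
  exact abs_le.2 ⟨by linarith, by linarith⟩

lemma MonotoneOn.exists_measurableSet_uniform_approx {g : ℝ → ℝ} {c d : ℝ}
    (hg : MonotoneOn g (Ioo c d)) {ε : ℝ} (hε : 0 < ε) {η : ENNReal} (hη : η ≠ 0) :
    ∃ E : Set ℝ, MeasurableSet E ∧
      volume ((Ioo c d ∩ {x | DifferentiableAt ℝ g x}) \ E) ≤ η ∧
      ∃ δ > 0, ∀ x ∈ E, ∀ y ∈ Ioo c d, |y - x| < δ →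
        |g y - g x - deriv g x * (y - x)| ≤ ε * |y - x| := by
  classical
  set s := Ioo c d ∩ {x | DifferentiableAt ℝ g x} with hs
  have hsm : MeasurableSet s := measurableSet_Ioo.inter (measurableSet_of_differentiableAt ℝ g)
  have hgs : Measurable (s.piecewise g 0) := ContinuousOn.measurable_piecewise
    (fun x hx => hx.2.continuousAt.continuousWithinAt) continuousOn_const hsm
  set E : ℕ → Set ℝ := fun n => s ∩ ⋂ q : ℚ, ⋂ _ : (q : ℝ) ∈ Ioo c d,
    {x | |q - x| < 1 / ((n : ℝ) + 1) →
      |g q - s.piecewise g 0 x - deriv g x * (q - x)| ≤ ε * |q - x|} with hE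
  have hEm : ∀ n, MeasurableSet (E n) := fun n => by
    refine hsm.inter (.iInter fun q => .iInter fun _ => ?_)
    have hd := measurable_deriv g
    have hA : MeasurableSet {x : ℝ | |q - x| < 1 / ((n : ℝ) + 1)} :=
      measurableSet_lt (by fun_prop) measurable_const
    have hB : MeasurableSet
        {x : ℝ | |g q - s.piecewise g 0 x - deriv g x * (q - x)| ≤ ε * |q - x|} :=
      measurableSet_le (by fun_prop) (by fun_prop)
    convert! hA.compl.union hB using 1
    ext x
    simp [imp_iff_not_or]
  have hmem : ∀ n x, x ∈ E n ↔ x ∈ s ∧ ∀ q : ℚ, (q : ℝ) ∈ Ioo c d →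
      |q - x| < 1 / ((n : ℝ) + 1) → |g q - g x - deriv g x * (q - x)| ≤ ε * |q - x| := by
    intro n x
    simp only [hE, mem_inter_iff, mem_iInter, mem_ofPred_eq]
    refine and_congr_right fun hx => ?_
    rw [piecewise_eq_of_mem _ _ _ hx]
  have hanti : Antitone fun n => s \ E n := fun n k hnk => by
    refine sdiff_subset_sdiff_right fun x hx => ?_
    rw [hmem] at hx ⊢
    exact ⟨hx.1, fun q hq hqx => hx.2 q hq (hqx.trans_le (Nat.one_div_le_one_div hnk))⟩
  have hinter : ⋂ n, s \ E n = ∅ := by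
    refine eq_empty_of_forall_notMem fun x hx => ?_
    rw [mem_iInter] at hx
    have hxs := (hx 0).1
    have hd := hasDerivAt_iff_isLittleO.1 hxs.2.hasDerivAt
    obtain ⟨δ, hδ, H⟩ := Metric.eventually_nhds_iff.1 (Asymptotics.isLittleO_iff.1 hd hε)
    obtain ⟨n, hn⟩ := exists_nat_one_div_lt hδ
    refine (hx n).2 ((hmem n x).2 ⟨hxs, fun q _ hqx => ?_⟩)
    have := H (y := (q : ℝ)) (hqx.trans hn)
    rwa [smul_eq_mul, mul_comm _ (deriv g x)] at this
  have hfin : volume (s \ E 0) ≠ ⊤ :=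
    ((measure_mono (sdiff_subset.trans inter_subset_left)).trans_lt measure_Ioo_lt_top).ne
  have hlim := tendsto_measure_iInter_atTop (μ := volume)
    (fun n => (hsm.diff (hEm n)).nullMeasurableSet) hanti ⟨0, hfin⟩
  rw [hinter, measure_empty] at hlim
  obtain ⟨n, hn⟩ := (hlim.eventually_lt_const (pos_iff_ne_zero.2 hη)).exists
  refine ⟨E n, hEm n, hn.le, 1 / ((n : ℝ) + 1), by positivity, fun x hx y hy hyx => ?_⟩
  exact hg.abs_sub_sub_le_of_forall_rat ((hmem n x).1 hx).2 hy hyx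

theorem MonotoneOn.exists_contDiff_one_eqOn_compact {g : ℝ → ℝ} {c d : ℝ}
    (hg : MonotoneOn g (Ioo c d)) {γ : ENNReal} (hγ : γ ≠ 0) :
    ∃ (G : ℝ → ℝ) (K : Set ℝ), ContDiff ℝ 1 G ∧ IsCompact K ∧ K ⊆ Ioo c d ∧
      volume (Ioo c d \ K) ≤ γ ∧ (∀ x ∈ K, ContinuousWithinAt g (Ioo c d) x) ∧
      ∀ x ∈ K, g x = G x := by
  have hγ2 : γ / 2 ≠ 0 := (ENNReal.half_pos hγ).ne'
  obtain ⟨η, hη, hηsum⟩ := ENNReal.exists_pos_sum_of_countable' hγ2 ℕ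
  set s := Ioo c d ∩ {x | DifferentiableAt ℝ g x} with hs
  have hsm : MeasurableSet s := measurableSet_Ioo.inter (measurableSet_of_differentiableAt ℝ g)
  choose E hEm hEη δ hδ hEδ using fun k : ℕ =>
    hg.exists_measurableSet_uniform_approx (Nat.one_div_pos_of_nat (α := ℝ) (n := k)) (hη k).ne'
  have hTm : MeasurableSet (s ∩ ⋂ k, E k) := hsm.inter (.iInter hEm)
  have hTfin : volume (s ∩ ⋂ k, E k) ≠ ⊤ :=
    ((measure_mono (inter_subset_left.trans inter_subset_left)).trans_lt measure_Ioo_lt_top).ne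
  obtain ⟨K, hKT, hK, hKγ⟩ := hTm.exists_isCompact_sdiff_lt hTfin hγ2
  obtain ⟨G, hG, hGK⟩ := hK.exists_contDiff_one_eqOn (f := g) (f' := deriv g) fun ε hε => by
    obtain ⟨k, hk⟩ := exists_nat_one_div_lt hε
    refine ⟨δ k, hδ k, fun x hx y hy hyx => ?_⟩
    refine (hEδ k x (mem_iInter.1 (hKT hx).2 k) y (hKT hy).1.1 hyx).trans ?_
    gcongr
  refine ⟨G, K, hG, hK, fun x hx => (hKT hx).1.1, ?_,
    fun x hx => (hKT hx).1.2.continuousAt.continuousWithinAt, fun x hx => (hGK hx).symm⟩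
  have hnull : volume (Ioo c d \ s) = 0 := by
    refine measure_mono_null (t := {x | ¬ (x ∈ Ioo c d → DifferentiableWithinAt ℝ g (Ioo c d) x)})
      ?_ hg.ae_differentiableWithinAt_of_mem
    exact fun x hx hd => hx.2 ⟨hx.1, (hd hx.1).differentiableAt (Ioo_mem_nhds hx.1.1 hx.1.2)⟩
  have hsub : Ioo c d \ K ⊆ (Ioo c d \ s ∪ ⋃ k, s \ E k) ∪ (s ∩ ⋂ k, E k) \ K := by
    intro x hx
    by_cases hxs : x ∈ s
    · by_cases hxE : x ∈ ⋂ k, E k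
      · exact Or.inr ⟨⟨hxs, hxE⟩, hx.2⟩
      · rw [mem_iInter, not_forall] at hxE
        exact Or.inl (Or.inr (mem_iUnion.2 (hxE.imp fun k hk => ⟨hxs, hk⟩)))
    · exact Or.inl (Or.inl ⟨hx.1, hxs⟩)
  calc volume (Ioo c d \ K)
      ≤ volume (Ioo c d \ s) + volume (⋃ k, s \ E k) + volume ((s ∩ ⋂ k, E k) \ K) :=
        (measure_mono hsub).trans ((measure_union_le _ _).trans
          (by gcongr; exact measure_union_le _ _))
    _ ≤ 0 + γ / 2 + γ / 2 := by
        gcongr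
        · exact hnull.le
        · exact (measure_iUnion_le _).trans ((ENNReal.tsum_le_tsum hEη).trans hηsum.le)
    _ = γ := by rw [zero_add, ENNReal.add_halves]

/-- Lusin-type `C¹`-approximation of a monotone function on a bounded open interval:
if `g` is monotone (non-decreasing or non-increasing) on `(c,d)`, then for every `γ > 0`
there are `G ∈ C¹(ℝ)` and a compact `K ⊂ (c,d)` with `λ¹((c,d) \ K) ≤ γ` such that `g` is
continuous at every point of `K` and `g = G` on `K`. -/
theorem stmt8 (c d : ℝ) (hcd : c < d) (g : ℝ → ℝ)
    (hg : MonotoneOn g (Set.Ioo c d) ∨ AntitoneOn g (Set.Ioo c d)) :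
    ∀ γ : ℝ, 0 < γ → ∃ (G : ℝ → ℝ) (K : Set ℝ), ContDiff ℝ 1 G ∧ IsCompact K ∧
      K ⊆ Set.Ioo c d ∧ volume (Set.Ioo c d \ K) ≤ ENNReal.ofReal γ ∧
      (∀ x ∈ K, ContinuousWithinAt g (Set.Ioo c d) x) ∧ (∀ x ∈ K, g x = G x) := by
  intro γ hγ
  have hγ' : ENNReal.ofReal γ ≠ 0 := (ENNReal.ofReal_pos.2 hγ).ne'
  rcases hg with hg | hg
  · exact hg.exists_contDiff_one_eqOn_compact hγ'
  · obtain ⟨G, K, hG, hK, hKs, hKγ, hcont, heq⟩ := hg.neg.exists_contDiff_one_eqOn_compact hγ'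
    refine ⟨-G, K, hG.neg, hK, hKs, hKγ, fun x hx => ?_, fun x hx => ?_⟩
    · simpa only [Pi.neg_def, neg_neg] using (hcont x hx).neg
    · rw [Pi.neg_apply, ← heq x hx, neg_neg]
end

section
/- Let O ⊂ ℝ^m be Lebesgue measurable and let {F_n : ℝ^m → ℝ, n ≥ 1} be a sequence of measurable functions that converges λ^m-almost everywhere and has uniformly dominated increments on O. Then the sequence {F_n·1_O} is uniformly approximatively Lipschitz: for every δ > 0 and R < ∞ there exist a compact set K_{δ,R} ⊂ ℝ^m and a constant L_{δ,R} < ∞ such that λ^m(B(0,R) \ K_{δ,R}) < δ and, for every n, the restriction of F_n·1_O to K_{δ,R} is Lipschitz with constant L_{δ,R}. -/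
open MeasureTheory Set Filter

open scoped Topology

/-- If a countable family of measurable functions is Lipschitz with constant `L` on a set `E`, then
it is so on a measurable set containing `E`. -/
lemma exists_measurableSet_superset_lipschitzOnWith {X ι : Type*} [PseudoMetricSpace X]
    [MeasurableSpace X] [OpensMeasurableSpace X] [Countable ι] {f : ι → X → ℝ}
    (hf : ∀ n, Measurable (f n)) {E : Set X} {L : NNReal}
    (hE : ∀ n, LipschitzOnWith L (f n) E) :
    ∃ M, MeasurableSet M ∧ E ⊆ M ∧ ∀ n, LipschitzOnWith L (f n) M := by
  choose g hgL hgE using fun n => (hE n).extend_real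
  refine ⟨⋂ n, {x | f n x = g n x}, ?_, ?_, fun n => ?_⟩
  · exact MeasurableSet.iInter fun n =>
      measurableSet_eq_fun (hf n) (hgL n).continuous.measurable
  · exact fun x hx => mem_iInter.2 fun n => hgE n hx
  · intro x hx y hy
    have hgx (w : X) (hw : w ∈ ⋂ n, {x | f n x = g n x}) : f n w = g n w := mem_iInter.1 hw n
    rw [hgx x hx, hgx y hy]
    exact hgL n x y

/-- If a countable family of measurable functions is pointwise bounded and pointwise Lipschitz,
uniformly in the index, at almost every point of a set `S` of finite measure, then it is uniformly
Lipschitz on a compact subset of `S` of almost full measure. -/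
lemma exists_isCompact_lipschitzOnWith {X ι : Type*} [MetricSpace X] [MeasurableSpace X]
    [BorelSpace X] [Countable ι] {μ : Measure X} [μ.InnerRegularCompactLTTop] {f : ι → X → ℝ}
    (hf : ∀ n, Measurable (f n)) {S : Set X} (hS : MeasurableSet S) (hμS : μ S ≠ ⊤)
    (hbdd : ∀ᵐ x ∂μ, x ∈ S → ∃ C : ℝ, ∀ n, |f n x| ≤ C)
    (hloc : ∀ᵐ x ∂μ, x ∈ S → ∃ C : ℝ, ∀ᶠ y in 𝓝[S] x, ∀ n, |f n y - f n x| ≤ C * dist y x)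
    {ε : ENNReal} (hε : ε ≠ 0) :
    ∃ (K : Set X) (L : NNReal), K ⊆ S ∧ IsCompact K ∧ μ (S \ K) < ε ∧
      ∀ n, LipschitzOnWith L (f n) K := by
  let E : ℕ → Set X := fun k => {x ∈ S | ∀ n, |f n x| ≤ k ∧
    ∀ y ∈ S, dist y x * (k + 1) < 1 → |f n y - f n x| ≤ k * dist y x}
  have hElip (k : ℕ) (n : ι) : LipschitzOnWith (2 * k * (k + 1) : NNReal) (f n) (E k) := by
    refine LipschitzOnWith.of_dist_le_mul fun x hx y hy => ?_
    have hk : (0 : ℝ) ≤ k := k.cast_nonneg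
    have hd : 0 ≤ dist x y := dist_nonneg
    rw [Real.dist_eq]
    push_cast
    by_cases h : dist x y * (k + 1) < 1
    · refine ((hy.2 n).2 x hx.1 h).trans ?_
      gcongr
      nlinarith
    · have h1 := (abs_sub (f n x) (f n y)).trans (add_le_add (hx.2 n).1 (hy.2 n).1)
      nlinarith
  choose M hMm hEM hML using fun k => exists_measurableSet_superset_lipschitzOnWith hf (hElip k)
  let N : ℕ → Set X := fun k => ⋂ j ≥ k, M j
  have hNm (k : ℕ) : MeasurableSet (N k) :=
    MeasurableSet.iInter fun j => MeasurableSet.iInter fun _ => hMm j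
  have hNmono : Monotone N := fun a b hab => biInter_subset_biInter_left fun j hj => hab.trans hj
  have hEmono : Monotone E := by
    refine fun a b hab x hx => ⟨hx.1, fun n => ⟨(hx.2 n).1.trans (by exact_mod_cast hab), ?_⟩⟩
    intro y hy hyx
    have hab' : (a : ℝ) ≤ b := by exact_mod_cast hab
    refine ((hx.2 n).2 y hy (lt_of_le_of_lt ?_ hyx)).trans ?_ <;> gcongr
  have hEN (k : ℕ) : E k ⊆ N k := subset_iInter₂ fun j hj => (hEmono hj).trans (hEM j)
  have hcover : ∀ᵐ x ∂μ, x ∈ S → ∃ k, x ∈ E k := by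
    filter_upwards [hbdd, hloc] with x h1 h2 hxS
    obtain ⟨C, hC⟩ := h1 hxS
    obtain ⟨D, hD⟩ := h2 hxS
    obtain ⟨r, hr, hrD⟩ := Metric.mem_nhdsWithin_iff.1 hD
    obtain ⟨k, hk⟩ := exists_nat_ge (max (max C D) r⁻¹)
    have hkC : C ≤ k := (le_max_left _ _).trans ((le_max_left _ _).trans hk)
    have hkD : D ≤ k := (le_max_right _ _).trans ((le_max_left _ _).trans hk)
    have hkr : r⁻¹ ≤ k := (le_max_right _ _).trans hk
    refine ⟨k, hxS, fun n => ⟨(hC n).trans hkC, fun y hy hyx => ?_⟩⟩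
    have hyr : dist y x < r := by
      have h1k : 1 ≤ k * r := by
        simpa [hr.ne'] using mul_le_mul_of_nonneg_right hkr hr.le
      have hk0 : (0 : ℝ) ≤ k := k.cast_nonneg
      by_contra! hcon
      nlinarith
    refine (hrD ⟨hyr, hy⟩ n).trans ?_
    gcongr
  have hlim : Tendsto (fun k => μ (S \ N k)) atTop (𝓝 0) := by
    have h := tendsto_measure_iInter_atTop (μ := μ) (s := fun k => S \ N k)
      (fun k => (hS.diff (hNm k)).nullMeasurableSet)
      (fun a b hab => sdiff_subset_sdiff_right (hNmono hab))
      ⟨0, measure_ne_top_of_subset sdiff_subset hμS⟩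
    have h0 : μ (⋂ k, S \ N k) = 0 := by
      refine measure_mono_null (fun x hx => ?_) (ae_iff.1 hcover)
      rw [mem_iInter] at hx
      exact fun hc => let ⟨k, hk⟩ := hc (hx 0).1; (hx k).2 (hEN k hk)
    rwa [h0] at h
  have hε2 : ε / 2 ≠ 0 := (ENNReal.half_pos hε).ne'
  obtain ⟨k, hk⟩ := (hlim.eventually (gt_mem_nhds (pos_iff_ne_zero.2 hε2))).exists
  obtain ⟨K, hKsub, hK, hKμ⟩ := (hS.inter (hNm k)).exists_isCompact_sdiff_lt
    (measure_ne_top_of_subset inter_subset_left hμS) hε2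
  refine ⟨K, _, hKsub.trans inter_subset_left, hK, ?_, fun n => (hML k n).mono fun x hx =>
    mem_iInter₂.1 (hKsub hx).2 k le_rfl⟩
  calc μ (S \ K) ≤ μ (S \ N k ∪ (S ∩ N k) \ K) := measure_mono fun x hx => by
        by_cases h : x ∈ N k
        · exact Or.inr ⟨⟨hx.1, h⟩, hx.2⟩
        · exact Or.inl ⟨hx.1, h⟩
    _ ≤ μ (S \ N k) + μ ((S ∩ N k) \ K) := measure_union_le _ _
    _ < ε / 2 + ε / 2 := ENNReal.add_lt_add hk hKμ
    _ = ε := ENNReal.add_halves ε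

lemma quasiMeasurePreserving_euclideanSpace_apply {ι : Type*} [Fintype ι] (i : ι) :
    Measure.QuasiMeasurePreserving (fun x : EuclideanSpace ℝ ι => x i) :=
  (Measure.quasiMeasurePreserving_eval (fun _ : ι => (volume : Measure ℝ)) i).comp
    (PiLp.volume_preserving_ofLp ι).quasiMeasurePreserving

/-- Functions with uniformly dominated increments on `O` are, at almost every point,
pointwise Lipschitz along `O` uniformly in the index. -/
lemma ae_exists_eventually_abs_sub_le_of_dominated {ι κ : Type*} [Fintype κ]
    {O : Set (EuclideanSpace ℝ κ)} {F : ι → EuclideanSpace ℝ κ → ℝ}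
    {ϱ : EuclideanSpace ℝ κ → ℝ} (hϱpos : ∀ᵐ z, 0 < ϱ z)
    {G : κ → EuclideanSpace ℝ κ → ℝ → ℝ} (hGmono : ∀ᵐ z, ∀ i, Monotone (G i z))
    (hdom : ∀ (n : ι) (z t s : EuclideanSpace ℝ κ),
      ‖t‖ < ϱ z → ‖s‖ < ϱ z → z + t ∈ O → z + s ∈ O →
      |F n (z + t) - F n (z + s)| ≤
        ∑ i, (G i z (max (t i) (s i)) - G i z (min (t i) (s i)))) :
    ∀ᵐ x, x ∈ O → ∃ C : ℝ, ∀ᶠ y in 𝓝[O] x, ∀ n, |F n y - F n x| ≤ C * dist y x := by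
  let A : Set (EuclideanSpace ℝ κ) := {z | 0 < ϱ z ∧ ∀ i, Monotone (G i z)}
  obtain ⟨T, hTA, hTc, hTU⟩ := TopologicalSpace.isOpen_biUnion_countable A (fun z => Metric.ball z (ϱ z))
    fun _ _ => Metric.isOpen_ball
  have hdiff : ∀ᵐ x : EuclideanSpace ℝ κ, ∀ z ∈ T, ∀ i, DifferentiableAt ℝ (G i z) ((x - z) i) := by
    refine (ae_ball_iff hTc).2 fun z hz => ae_all_iff.2 fun i => ?_
    exact ((quasiMeasurePreserving_euclideanSpace_apply i).comp
      (measurePreserving_sub_right volume z).quasiMeasurePreserving).ae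
        ((hTA hz).2 i).ae_differentiableAt
  filter_upwards [hϱpos, hGmono, hdiff] with x hx1 hx2 hx3 hxO
  have hxU : x ∈ ⋃ z ∈ T, Metric.ball z (ϱ z) := by
    rw [hTU]
    exact mem_biUnion (show x ∈ A from ⟨hx1, hx2⟩) (Metric.mem_ball_self hx1)
  obtain ⟨z, hzT, hxz⟩ := mem_iUnion₂.1 hxU
  have hmono := (hTA hzT).2
  choose C hC using fun i => (hx3 z hzT i).isBigO_sub.bound
  have hcont (i : κ) : Tendsto (fun y : EuclideanSpace ℝ κ => (y - z) i) (𝓝 x) (𝓝 ((x - z) i)) :=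
    Continuous.tendsto (by fun_prop) x
  refine ⟨∑ i, |C i|, ?_⟩
  filter_upwards [self_mem_nhdsWithin,
    mem_nhdsWithin_of_mem_nhds (Metric.isOpen_ball.mem_nhds hxz),
    mem_nhdsWithin_of_mem_nhds (eventually_all.2 fun i => (hcont i).eventually (hC i))]
    with y hyO hyz hyC n
  have h := hdom n z (y - z) (x - z) (by rwa [← dist_eq_norm]) (by rwa [← dist_eq_norm])
    (by simpa using hyO) (by simpa using hxO)
  rw [add_sub_cancel, add_sub_cancel] at h
  refine h.trans ?_
  rw [Finset.sum_mul]
  refine Finset.sum_le_sum fun i _ => ?_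
  have hmm : G i z (max ((y - z) i) ((x - z) i)) - G i z (min ((y - z) i) ((x - z) i)) =
      |G i z ((y - z) i) - G i z ((x - z) i)| := by
    rw [(hmono i).map_max, (hmono i).map_min, max_sub_min_eq_abs']
  have hi : ‖(y - z) i - (x - z) i‖ ≤ dist y x := by
    rw [← PiLp.sub_apply, sub_sub_sub_cancel_right, dist_eq_norm]
    exact PiLp.norm_apply_le _ i
  rw [hmm, ← Real.norm_eq_abs]
  calc _ ≤ C i * ‖(y - z) i - (x - z) i‖ := hyC i
    _ ≤ |C i| * ‖(y - z) i - (x - z) i‖ := by gcongr; exact le_abs_self _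
    _ ≤ |C i| * dist y x := by gcongr

/-- If measurable functions `F n : ℝ^m → ℝ` converge `λ^m`-a.e. and have uniformly
dominated increments on a measurable set `O` (with radial bound `ϱ > 0` a.e. and
dominating increasing functions `G i z (·)`), then the sequence `{F n · 1_O}` is
uniformly approximatively Lipschitz: for all `δ > 0`, `R`, there are a compact `K` and a
Lipschitz constant `L` with `λ^m (B(0,R) \ K) < δ` and every `F n · 1_O` Lipschitz with
constant `L` on `K`. -/
theorem stmt9 (m : ℕ) (O : Set (EuclideanSpace ℝ (Fin m))) (hO : MeasurableSet O)
    (F : ℕ → EuclideanSpace ℝ (Fin m) → ℝ) (hFmeas : ∀ n, Measurable (F n))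
    (hconv : ∀ᵐ z : EuclideanSpace ℝ (Fin m) ∂volume,
      ∃ l : ℝ, Tendsto (fun n => F n z) atTop (nhds l))
    (ϱ : EuclideanSpace ℝ (Fin m) → ℝ) (hϱmeas : Measurable ϱ)
    (hϱpos : ∀ᵐ z : EuclideanSpace ℝ (Fin m) ∂volume, 0 < ϱ z)
    (G : Fin m → EuclideanSpace ℝ (Fin m) → ℝ → ℝ)
    (hGmeas : ∀ i, Measurable (Function.uncurry (G i)))
    (hGmono : ∀ᵐ z : EuclideanSpace ℝ (Fin m) ∂volume, ∀ i, Monotone (G i z))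
    (hdom : ∀ (n : ℕ) (z t s : EuclideanSpace ℝ (Fin m)),
      ‖t‖ < ϱ z → ‖s‖ < ϱ z → z + t ∈ O → z + s ∈ O →
      |F n (z + t) - F n (z + s)| ≤
        ∑ i : Fin m, (G i z (max (t i) (s i)) - G i z (min (t i) (s i)))) :
    ∀ δ : ℝ, 0 < δ → ∀ R : ℝ, ∃ (K : Set (EuclideanSpace ℝ (Fin m))) (L : NNReal),
      IsCompact K ∧ volume (Metric.ball (0 : EuclideanSpace ℝ (Fin m)) R \ K)
        < ENNReal.ofReal δ ∧
      ∀ n : ℕ, LipschitzOnWith L (Set.indicator O (F n)) K := by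
  intro δ hδ R
  set B := Metric.ball (0 : EuclideanSpace ℝ (Fin m)) R
  have hB : MeasurableSet B := Metric.isOpen_ball.measurableSet
  have hBfin : volume B ≠ ⊤ := measure_ball_lt_top.ne
  set ε : ENNReal := ENNReal.ofReal δ / 3
  have hε : ε ≠ 0 := by simp [ε, hδ]
  obtain ⟨K₁, hK₁O, hK₁, hK₁μ⟩ := (hB.inter hO).exists_isCompact_sdiff_lt
    (measure_ne_top_of_subset inter_subset_left hBfin) hε
  obtain ⟨K₂, hK₂O, hK₂, hK₂μ⟩ := (hB.diff hO).exists_isCompact_sdiff_lt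
    (measure_ne_top_of_subset sdiff_subset hBfin) hε
  have hfm (n : ℕ) : Measurable (O.indicator (F n)) := (hFmeas n).indicator hO
  have hbdd : ∀ᵐ x, x ∈ K₁ ∪ K₂ → ∃ C : ℝ, ∀ n, |O.indicator (F n) x| ≤ C := by
    filter_upwards [hconv] with x ⟨l, hl⟩ _
    obtain ⟨C, hC⟩ := hl.abs.bddAbove_range
    refine ⟨C, fun n => ?_⟩
    rw [← Real.norm_eq_abs]
    exact (norm_indicator_le_norm_self _ _).trans (hC (mem_range_self n))
  have hloc : ∀ᵐ x, x ∈ K₁ ∪ K₂ → ∃ C : ℝ, ∀ᶠ y in 𝓝[K₁ ∪ K₂] x, ∀ n,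
      |O.indicator (F n) y - O.indicator (F n) x| ≤ C * dist y x := by
    filter_upwards [ae_exists_eventually_abs_sub_le_of_dominated hϱpos hGmono hdom] with x hx hxK
    by_cases hxO : x ∈ O
    · obtain ⟨C, hC⟩ := hx hxO
      refine ⟨C, ?_⟩
      filter_upwards [self_mem_nhdsWithin, mem_nhdsWithin_of_mem_nhds
        (hK₂.isClosed.isOpen_compl.mem_nhds fun h => (hK₂O h).2 hxO),
        mem_nhdsWithin_of_mem_nhds (eventually_nhdsWithin_iff.1 hC)] with y hy hy2 hyC n
      have hyO : y ∈ O := (hK₁O (hy.resolve_right hy2)).2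
      simpa [hyO, hxO] using hyC hyO n
    · refine ⟨0, ?_⟩
      filter_upwards [self_mem_nhdsWithin, mem_nhdsWithin_of_mem_nhds
        (hK₁.isClosed.isOpen_compl.mem_nhds fun h => hxO (hK₁O h).2)] with y hy hy1 n
      have hyO : y ∉ O := (hK₂O (hy.resolve_left hy1)).2
      simp [hyO, hxO]
  obtain ⟨K, L, -, hK, hKμ, hKL⟩ := exists_isCompact_lipschitzOnWith hfm
    (hK₁.union hK₂).measurableSet (hK₁.union hK₂).measure_ne_top hbdd hloc hε
  refine ⟨K, L, hK, ?_, hKL⟩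
  calc volume (B \ K)
      ≤ volume ((B ∩ O) \ K₁ ∪ (B \ O) \ K₂ ∪ (K₁ ∪ K₂) \ K) := measure_mono fun x hx => by
        have := hx.1
        have := hx.2
        simp only [mem_union, Set.mem_sdiff, mem_inter_iff]
        tauto
    _ ≤ volume ((B ∩ O) \ K₁) + volume ((B \ O) \ K₂) + volume ((K₁ ∪ K₂) \ K) :=
      (measure_union_le _ _).trans (by gcongr; exact measure_union_le _ _)
    _ < ε + ε + ε := ENNReal.add_lt_add (ENNReal.add_lt_add hK₁μ hK₂μ) hKμ
    _ = ENNReal.ofReal δ := ENNReal.add_thirds _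
end
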